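/- Define ς(x_1, x_2) = G(x_1 + ρ(x_2)) − G(x_1). There exists a constant C ∈ (0,∞) such that for every n ∈ ℕ with δ = T/n ∈ (0,1), it holds that E[ sup_{τ∈[0,T]} | ∫_{(0,τ]} ( ς(X^{(δ)}_{s̲}, X^{(δ)}_{s̲}) − ς(X^{(δ)}_{s−}, X^{(δ)}_{s̲}) ) dN_s |^2 ] ≤ C δ, where X^{(δ)}_{s−} denotes the left limit, and the integral is the pathwise Lebesgue–Stieltjes integral with respect to the nondecreasing function s ↦ N_s(ω), i.e. the sum of the integrand over the jump times of N in (0,τ]. -/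

import Mathlib

open MeasureTheory ProbabilityTheory

/-- Grid values of the Euler–Maruyama scheme with step size `δ` and initial value `x`. -/
noncomputable def emGrid {Ω : Type*} (μ σ ρ : ℝ → ℝ) (W N : ℝ → Ω → ℝ)
    (δ : ℝ) (x : ℝ) : ℕ → Ω → ℝ
  | 0, _ => x
  | (j + 1), ω =>
      emGrid μ σ ρ W N δ x j ω
        + μ (emGrid μ σ ρ W N δ x j ω) * δ
        + σ (emGrid μ σ ρ W N δ x j ω) * (W (((j : ℝ) + 1) * δ) ω - W ((j : ℝ) * δ) ω)
        + ρ (emGrid μ σ ρ W N δ x j ω) * (N (((j : ℝ) + 1) * δ) ω - N ((j : ℝ) * δ) ω)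

/-- The last grid point `t̲ = δ ⌊t/δ⌋` before time `t`. -/
noncomputable def lastGrid (δ t : ℝ) : ℝ := (⌊t / δ⌋.toNat : ℝ) * δ

/-- The continuous-time Euler–Maruyama scheme
`X_t = X_t̲ + μ(X_t̲)(t - t̲) + σ(X_t̲)(W_t - W_t̲) + ρ(X_t̲)(N_t - N_t̲)`. -/
noncomputable def emProc {Ω : Type*} (μ σ ρ : ℝ → ℝ) (W N : ℝ → Ω → ℝ)
    (δ : ℝ) (x : ℝ) (t : ℝ) (ω : Ω) : ℝ :=
  emGrid μ σ ρ W N δ x (⌊t / δ⌋.toNat) ω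
    + μ (emGrid μ σ ρ W N δ x (⌊t / δ⌋.toNat) ω) * (t - lastGrid δ t)
    + σ (emGrid μ σ ρ W N δ x (⌊t / δ⌋.toNat) ω) * (W t ω - W (lastGrid δ t) ω)
    + ρ (emGrid μ σ ρ W N δ x (⌊t / δ⌋.toNat) ω) * (N t ω - N (lastGrid δ t) ω)

/-- The bump function `φ(u) = (1+u)^3 (1-u)^3` for `|u| ≤ 1` and `φ(u) = 0` otherwise. -/
noncomputable def bumpPhi (u : ℝ) : ℝ := if |u| ≤ 1 then (1 + u) ^ 3 * (1 - u) ^ 3 else 0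

/-- The transform `G(x) = x + ∑ k, α k * φ((x - ζ k)/c) * (x - ζ k) * |x - ζ k|`. -/
noncomputable def Gtransform (m : ℕ) (ζ α : Fin m → ℝ) (c : ℝ) (x : ℝ) : ℝ :=
  x + ∑ k : Fin m, α k * bumpPhi ((x - ζ k) / c) * ((x - ζ k) * |x - ζ k|)

/-- The `j`-th jump time of the counting process `N`:
`τ_j = inf {t ≥ 0 : N_t ≥ j}`. -/
noncomputable def jumpTime {Ω : Type*} (N : ℝ → Ω → ℝ) (j : ℕ) (ω : Ω) : ℝ :=
  sInf {t : ℝ | 0 ≤ t ∧ (j : ℝ) ≤ N t ω}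

/-- The jump coefficient `ς(x₁, x₂) = G(x₁ + ρ(x₂)) - G(x₁)`. -/
noncomputable def sigmaJump (G ρ : ℝ → ℝ) (x₁ x₂ : ℝ) : ℝ :=
  G (x₁ + ρ x₂) - G x₁

section EMHelpers

open Filter Topology

lemma emh_poisson_hasSum1 (r : NNReal) :
    HasSum (fun n : ℕ => Real.exp (-r) * (r:ℝ) ^ n / (n.factorial : ℝ) * (n:ℝ)) r := by
  rw [← hasSum_nat_add_iff' 1]
  have h := (hasSum_one_poissonMeasure r).mul_left (r:ℝ)
  simp only [Finset.range_one, Finset.sum_singleton, Nat.cast_zero, mul_zero, sub_zero]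
  rw [mul_one] at h
  refine h.congr_fun ?_ |> fun h => h
  intro n
  have : ((n+1).factorial : ℝ) = (n+1) * n.factorial := by
    rw [Nat.factorial_succ]; push_cast; ring
  have h1 : (n.factorial : ℝ) ≠ 0 := by positivity
  have h2 : (n + 1 : ℝ) ≠ 0 := by positivity
  rw [this]; push_cast; field_simp; ring

lemma emh_poisson_hasSum2 (r : NNReal) :
    HasSum (fun n : ℕ => Real.exp (-r) * (r:ℝ) ^ n / (n.factorial : ℝ) * (n:ℝ) ^ 2)
      ((r:ℝ) * (r + 1)) := by
  rw [← hasSum_nat_add_iff' 1]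
  have h := ((emh_poisson_hasSum1 r).add (hasSum_one_poissonMeasure r)).mul_left (r:ℝ)
  simp only [Finset.range_one, Finset.sum_singleton, Nat.cast_zero, ne_eq, OfNat.ofNat_ne_zero,
    not_false_eq_true, zero_pow, mul_zero, sub_zero]
  refine h.congr_fun ?_ |> fun h => h
  intro n
  have : ((n+1).factorial : ℝ) = (n+1) * n.factorial := by
    rw [Nat.factorial_succ]; push_cast; ring
  have h1 : (n.factorial : ℝ) ≠ 0 := by positivity
  have h2 : (n + 1 : ℝ) ≠ 0 := by positivity
  rw [this]; push_cast; field_simp; try ring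

lemma emh_poisson_hasSum3 (r : NNReal) :
    HasSum (fun n : ℕ => Real.exp (-r) * (r:ℝ) ^ n / (n.factorial : ℝ) * ((n:ℝ) - r) ^ 2)
      (r:ℝ) := by
  have h := ((emh_poisson_hasSum2 r).add ((emh_poisson_hasSum1 r).mul_left (-2 * (r:ℝ)))).add
    ((hasSum_one_poissonMeasure r).mul_left ((r:ℝ)^2))
  convert h using 1
  · ext n; ring
  · ring

lemma emh_poisson_int1 (r : NNReal) :
    Integrable (fun k : ℕ => (k:ℝ)) (poissonMeasure r) ∧
      ∫ k : ℕ, (k:ℝ) ∂(poissonMeasure r) = r := by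
  constructor
  · rw [integrable_poissonMeasure_iff]
    simpa [Real.norm_eq_abs] using (emh_poisson_hasSum1 r).summable
  · rw [integral_poissonMeasure]
    simpa using (emh_poisson_hasSum1 r).tsum_eq

lemma emh_poisson_int2 (r : NNReal) :
    MemLp (fun k : ℕ => (k:ℝ) - r) 2 (poissonMeasure r) ∧
      ∫ k : ℕ, ((k:ℝ) - r) ^ 2 ∂(poissonMeasure r) = r := by
  constructor
  · rw [memLp_two_iff_integrable_sq (by fun_prop), integrable_poissonMeasure_iff]
    simpa [Real.norm_eq_abs] using (emh_poisson_hasSum3 r).summable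
  · rw [integral_poissonMeasure]
    simpa using (emh_poisson_hasSum3 r).tsum_eq

/-- Moment and independence facts of the driving noise. -/
structure EMNoise {Ω : Type*} {m0 : MeasurableSpace Ω} (F : Filtration ℝ m0) (P : Measure Ω)
    (T L : ℝ) (W N : ℝ → Ω → ℝ) (κ : ℝ → ℝ → ℝ) : Prop where
  L0 : 0 ≤ L
  mW : ∀ t, 0 ≤ t → t ≤ T → Measurable[F t] (W t)
  mN : ∀ t, 0 ≤ t → t ≤ T → Measurable[F t] (N t)
  iW : ∀ s t, 0 ≤ s → s ≤ t → t ≤ T →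
    Indep (F s) (MeasurableSpace.comap (fun ω => W t ω - W s ω) inferInstance) P
  iN : ∀ s t, 0 ≤ s → s ≤ t → t ≤ T →
    Indep (F s) (MeasurableSpace.comap (fun ω => N t ω - N s ω - κ s t) inferInstance) P
  lW : ∀ s t, 0 ≤ s → s ≤ t → t ≤ T → MemLp (fun ω => W t ω - W s ω) 2 P
  eW : ∀ s t, 0 ≤ s → s ≤ t → t ≤ T → ∫ ω, (W t ω - W s ω) ∂P = 0
  vW : ∀ s t, 0 ≤ s → s ≤ t → t ≤ T → ∫ ω, (W t ω - W s ω) ^ 2 ∂P = t - s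
  lN : ∀ s t, 0 ≤ s → s ≤ t → t ≤ T → MemLp (fun ω => N t ω - N s ω - κ s t) 2 P
  eN : ∀ s t, 0 ≤ s → s ≤ t → t ≤ T → ∫ ω, (N t ω - N s ω - κ s t) ∂P = 0
  vN : ∀ s t, 0 ≤ s → s ≤ t → t ≤ T → ∫ ω, (N t ω - N s ω - κ s t) ^ 2 ∂P = κ s t
  κ0 : ∀ s t, 0 ≤ s → s ≤ t → t ≤ T → 0 ≤ κ s t
  κL : ∀ s t, 0 ≤ s → s ≤ t → t ≤ T → κ s t ≤ L * (t - s)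

lemma emh_noise {Ω : Type*} {m0 : MeasurableSpace Ω}
    (F : Filtration ℝ m0) (P : Measure Ω) [IsProbabilityMeasure P]
    (T : ℝ) (hT : 0 < T)
    (lam : ℝ → ℝ) (hlam_meas : Measurable lam)
    (hlam_pos : ∀ t ∈ Set.Icc (0:ℝ) T, 0 < lam t)
    (lamB : ℝ) (hlamB : ∀ t ∈ Set.Icc (0:ℝ) T, lam t ≤ lamB)
    (W N : ℝ → Ω → ℝ)
    (hW_adapted : ∀ t ∈ Set.Icc (0:ℝ) T, Measurable[F t] (W t))
    (hN_adapted : ∀ t ∈ Set.Icc (0:ℝ) T, Measurable[F t] (N t))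
    (hW_gauss : ∀ s t : ℝ, 0 ≤ s → s ≤ t → t ≤ T →
      Measure.map (fun ω => W t ω - W s ω) P = gaussianReal 0 (Real.toNNReal (t - s)))
    (hN_poisson : ∀ s t : ℝ, 0 ≤ s → s ≤ t → t ≤ T →
      Measure.map (fun ω => N t ω - N s ω) P
        = Measure.map (fun k : ℕ => (k : ℝ))
            (poissonMeasure (Real.toNNReal (∫ u in s..t, lam u))))
    (h_indep : ∀ s t : ℝ, 0 ≤ s → s ≤ t → t ≤ T →
      Indep (MeasurableSpace.comap (fun ω => (W t ω - W s ω, N t ω - N s ω)) inferInstance)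
        (F s) P) :
    EMNoise F P T lamB W N (fun s t => ∫ u in s..t, lam u) := by
  have hmW : ∀ t, 0 ≤ t → t ≤ T → Measurable (W t) := fun t h0 h1 =>
    (hW_adapted t ⟨h0, h1⟩).mono (F.le t) le_rfl
  have hmN : ∀ t, 0 ≤ t → t ≤ T → Measurable (N t) := fun t h0 h1 =>
    (hN_adapted t ⟨h0, h1⟩).mono (F.le t) le_rfl
  have hdW : ∀ s t, 0 ≤ s → s ≤ t → t ≤ T → Measurable (fun ω => W t ω - W s ω) :=
    fun s t h0 h1 h2 => (hmW t (h0.trans h1) h2).sub (hmW s h0 (h1.trans h2))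
  have hdN : ∀ s t, 0 ≤ s → s ≤ t → t ≤ T → Measurable (fun ω => N t ω - N s ω) :=
    fun s t h0 h1 h2 => (hmN t (h0.trans h1) h2).sub (hmN s h0 (h1.trans h2))
  have hL : 0 ≤ lamB := by
    have h0 : (0:ℝ) ∈ Set.Icc 0 T := ⟨le_rfl, hT.le⟩
    exact (hlam_pos 0 h0).le.trans (hlamB 0 h0)
  have hκ0 : ∀ s t, 0 ≤ s → s ≤ t → t ≤ T → 0 ≤ ∫ u in s..t, lam u := by
    intro s t h0 h1 h2
    exact intervalIntegral.integral_nonneg h1 fun u hu =>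
      (hlam_pos u ⟨h0.trans hu.1, hu.2.trans h2⟩).le
  have hκL : ∀ s t, 0 ≤ s → s ≤ t → t ≤ T → ∫ u in s..t, lam u ≤ lamB * (t - s) := by
    intro s t h0 h1 h2
    have := intervalIntegral.norm_integral_le_of_norm_le_const (a := s) (b := t) (f := lam)
      (C := lamB) (fun u hu => by
        rw [Set.uIoc_of_le h1] at hu
        have hu' : u ∈ Set.Icc 0 T := ⟨h0.trans hu.1.le, hu.2.trans h2⟩
        rw [Real.norm_eq_abs, abs_of_pos (hlam_pos u hu')]
        exact hlamB u hu')
    rw [abs_of_nonneg (by linarith : 0 ≤ t - s)] at this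
    exact (le_abs_self _).trans this
  refine ⟨hL, fun t h0 h1 => hW_adapted t ⟨h0, h1⟩, fun t h0 h1 => hN_adapted t ⟨h0, h1⟩,
    ?_, ?_, ?_, ?_, ?_, ?_, ?_, ?_, hκ0, hκL⟩
  · intro s t h0 h1 h2
    refine indep_of_indep_of_le_right (h_indep s t h0 h1 h2).symm ?_
    rw [← measurable_iff_comap_le]
    exact measurable_fst.comp (comap_measurable _)
  · intro s t h0 h1 h2
    refine indep_of_indep_of_le_right (h_indep s t h0 h1 h2).symm ?_
    rw [← measurable_iff_comap_le]
    exact (measurable_snd.comp (comap_measurable _)).sub_const _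
  · intro s t h0 h1 h2
    have := memLp_id_gaussianReal' (μ := 0) (v := Real.toNNReal (t - s)) 2 (by simp)
    rw [← hW_gauss s t h0 h1 h2] at this
    exact this.comp_of_map (hdW s t h0 h1 h2).aemeasurable
  · intro s t h0 h1 h2
    have := integral_id_gaussianReal (μ := 0) (v := Real.toNNReal (t - s))
    rw [← hW_gauss s t h0 h1 h2, integral_map (hdW s t h0 h1 h2).aemeasurable
      (by fun_prop)] at this
    exact this
  · intro s t h0 h1 h2
    have := variance_fun_id_gaussianReal (μ := 0) (v := Real.toNNReal (t - s))
    rw [variance_of_integral_eq_zero (by fun_prop) (by simp)] at this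
    rw [← hW_gauss s t h0 h1 h2, integral_map (hdW s t h0 h1 h2).aemeasurable
      (by fun_prop), Real.coe_toNNReal _ (by linarith)] at this
    exact this
  · intro s t h0 h1 h2
    have h := (emh_poisson_int2 (Real.toNNReal (∫ u in s..t, lam u))).1
    rw [Real.coe_toNNReal _ (hκ0 s t h0 h1 h2)] at h
    have h' : MemLp (fun x : ℝ => x - ∫ u in s..t, lam u) 2
      (Measure.map (fun ω => N t ω - N s ω) P) := by
      rw [hN_poisson s t h0 h1 h2]
      rw [memLp_map_measure_iff (by fun_prop) (by fun_prop)]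
      exact h
    exact h'.comp_of_map (hdN s t h0 h1 h2).aemeasurable
  · intro s t h0 h1 h2
    have h := (emh_poisson_int1 (Real.toNNReal (∫ u in s..t, lam u)))
    rw [Real.coe_toNNReal _ (hκ0 s t h0 h1 h2)] at h
    have h' : ∫ x, (x - ∫ u in s..t, lam u) ∂(Measure.map (fun ω => N t ω - N s ω) P) = 0 := by
      rw [hN_poisson s t h0 h1 h2, integral_map (by fun_prop) (by fun_prop),
        integral_sub h.1 (integrable_const _), h.2]
      simp
    rwa [integral_map (hdN s t h0 h1 h2).aemeasurable (by fun_prop)] at h'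
  · intro s t h0 h1 h2
    have h := (emh_poisson_int2 (Real.toNNReal (∫ u in s..t, lam u))).2
    rw [Real.coe_toNNReal _ (hκ0 s t h0 h1 h2)] at h
    have h' : ∫ x, (x - ∫ u in s..t, lam u)^2 ∂(Measure.map (fun ω => N t ω - N s ω) P)
        = ∫ u in s..t, lam u := by
      rw [hN_poisson s t h0 h1 h2, integral_map (by fun_prop) (by fun_prop), h]
    rwa [integral_map (hdN s t h0 h1 h2).aemeasurable (by fun_prop)] at h'

lemma emh_mul {Ω : Type*} {m1 m0 : MeasurableSpace Ω} {P : Measure Ω} [IsProbabilityMeasure P]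
    (hm : m1 ≤ m0) {Y D : Ω → ℝ}
    (hY : Measurable[m1] Y) (hYL : MemLp Y 2 P) (hDL : MemLp D 2 P)
    (hi : Indep m1 (MeasurableSpace.comap D inferInstance) P) :
    MemLp (fun ω => Y ω * D ω) 2 P ∧
      ∫ ω, (Y ω * D ω) ^ 2 ∂P = (∫ ω, Y ω ^ 2 ∂P) * ∫ ω, D ω ^ 2 ∂P := by
  have hind : IndepFun Y D P := by
    rw [IndepFun_iff_Indep]
    exact indep_of_indep_of_le_left hi (measurable_iff_comap_le.mp hY)
  have hind2 : IndepFun (fun ω => Y ω ^ 2) (fun ω => D ω ^ 2) P :=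
    hind.comp (φ := fun x : ℝ => x ^ 2) (ψ := fun x : ℝ => x ^ 2) (by fun_prop) (by fun_prop)
  have h1 := hind2.integrable_mul hYL.integrable_sq hDL.integrable_sq
  have h2 := hind2.integral_fun_mul_eq_mul_integral hYL.integrable_sq.aestronglyMeasurable
    hDL.integrable_sq.aestronglyMeasurable
  constructor
  · refine (memLp_two_iff_integrable_sq
      (hYL.aestronglyMeasurable.mul hDL.aestronglyMeasurable)).mpr ?_
    refine h1.congr (ae_of_all _ fun ω => ?_)
    simp [mul_pow]
  · rw [← h2]
    congr 1; ext ω; ring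

lemma emh_mul_zero {Ω : Type*} {m1 m0 : MeasurableSpace Ω} {P : Measure Ω}
    [IsProbabilityMeasure P] (hm : m1 ≤ m0) {Y D : Ω → ℝ}
    (hY : Measurable[m1] Y) (hYL : Integrable Y P) (hDL : MemLp D 2 P)
    (hi : Indep m1 (MeasurableSpace.comap D inferInstance) P) (hD : ∫ ω, D ω ∂P = 0) :
    ∫ ω, Y ω * D ω ∂P = 0 := by
  have hind : IndepFun Y D P := by
    rw [IndepFun_iff_Indep]
    exact indep_of_indep_of_le_left hi (measurable_iff_comap_le.mp hY)
  rw [hind.integral_fun_mul_eq_mul_integral hYL.aestronglyMeasurable hDL.aestronglyMeasurable,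
    hD, mul_zero]

lemma emh_growth_memLp {Ω : Type*} {m0 : MeasurableSpace Ω} {P : Measure Ω}
    [IsProbabilityMeasure P] {X : Ω → ℝ} (hX : MemLp X 2 P) (hXm : Measurable X)
    {f : ℝ → ℝ} (hf : Measurable f) {K : ℝ} (hK : ∀ x, |f x| ≤ K * (1 + |x|)) :
    MemLp (fun ω => f (X ω)) 2 P ∧
      ∫ ω, f (X ω) ^ 2 ∂P ≤ 2 * K ^ 2 * (1 + ∫ ω, X ω ^ 2 ∂P) := by
  have hg : MemLp (fun ω => K * (1 + |X ω|)) 2 P :=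
    (((memLp_const (1:ℝ)).add hX.abs)).const_mul K
  have h1 : MemLp (fun ω => f (X ω)) 2 P := by
    refine hg.mono (hf.comp hXm).aestronglyMeasurable (ae_of_all _ fun ω => ?_)
    exact (hK _).trans (le_abs_self _)
  refine ⟨h1, ?_⟩
  have h2 : ∫ ω, f (X ω) ^ 2 ∂P ≤ ∫ ω, 2 * K ^ 2 * (1 + X ω ^ 2) ∂P := by
    refine integral_mono h1.integrable_sq
      (((integrable_const _).add hX.integrable_sq).const_mul _) fun ω => ?_
    have h := hK (X ω)
    have h3 : f (X ω) ^ 2 ≤ (K * (1 + |X ω|)) ^ 2 := by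
      rw [← sq_abs (f _)]; exact pow_le_pow_left₀ (abs_nonneg _) h 2
    have h4 : (1 + |X ω|) ^ 2 ≤ 2 * (1 + X ω ^ 2) := by
      nlinarith [sq_nonneg (1 - |X ω|), sq_abs (X ω)]
    show f (X ω) ^ 2 ≤ 2 * K ^ 2 * (1 + X ω ^ 2)
    nlinarith [sq_nonneg K]
  rw [integral_const_mul, integral_add (integrable_const _) hX.integrable_sq] at h2
  simpa using h2

/-- Increment of one Euler step from `s` to `t` started at `X`. -/
noncomputable def emhIncr {Ω : Type*} (μ σ ρ : ℝ → ℝ) (W N : ℝ → Ω → ℝ) (s t : ℝ) (X : Ω → ℝ)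
    (ω : Ω) : ℝ :=
  μ (X ω) * (t - s) + σ (X ω) * (W t ω - W s ω) + ρ (X ω) * (N t ω - N s ω)

set_option maxHeartbeats 1000000 in
lemma emh_step {Ω : Type*} {m0 : MeasurableSpace Ω} {F : Filtration ℝ m0} {P : Measure Ω}
    [IsProbabilityMeasure P] {T L : ℝ} {W N : ℝ → Ω → ℝ} {κ : ℝ → ℝ → ℝ}
    (H : EMNoise F P T L W N κ) {μ σ ρ : ℝ → ℝ} (hμ : Measurable μ) (hσ : Measurable σ)
    (hρ : Measurable ρ) {K : ℝ} (hμK : ∀ x, |μ x| ≤ K * (1 + |x|))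
    (hσK : ∀ x, |σ x| ≤ K * (1 + |x|)) (hρK : ∀ x, |ρ x| ≤ K * (1 + |x|)) :
    ∃ C : ℝ, 0 ≤ C ∧ ∀ s t, 0 ≤ s → s ≤ t → t ≤ T → t - s ≤ 1 → ∀ X : Ω → ℝ,
      Measurable[F s] X → MemLp X 2 P →
      Measurable[F t] (emhIncr μ σ ρ W N s t X) ∧ MemLp (emhIncr μ σ ρ W N s t X) 2 P ∧
      ∫ ω, (emhIncr μ σ ρ W N s t X ω) ^ 2 ∂P ≤ C * (t - s) * (1 + ∫ ω, X ω ^ 2 ∂P) ∧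
      ∫ ω, (X ω + emhIncr μ σ ρ W N s t X ω) ^ 2 ∂P
        ≤ ∫ ω, X ω ^ 2 ∂P + C * (t - s) * (1 + ∫ ω, X ω ^ 2 ∂P) := by
  have hK0 : 0 ≤ K := by
    have := (abs_nonneg _).trans (hμK 0)
    simpa using this
  have hL := H.L0
  -- `A² ≤ a h (1 + X²)` and `E B² ≤ b h (1 + E X²)`
  set a : ℝ := 2 * (K * (1 + L)) ^ 2 with ha
  set b : ℝ := 4 * K ^ 2 * (1 + L) with hb
  have ha0 : 0 ≤ a := by positivity
  have hb0 : 0 ≤ b := by positivity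
  refine ⟨2 * a + 2 * b + 3 * (K * (1 + L)), by positivity, ?_⟩
  intro s t h0 h1 h2 h3 X hXm hXL
  have h4 : 0 ≤ t := h0.trans h1
  have h5 : s ≤ T := h1.trans h2
  set h := t - s with hh
  have hh0 : 0 ≤ h := by linarith
  have hXm0 : Measurable X := hXm.mono (F.le s) le_rfl
  obtain ⟨lμ, -⟩ := emh_growth_memLp hXL hXm0 hμ hμK
  obtain ⟨lσ, eσ⟩ := emh_growth_memLp hXL hXm0 hσ hσK
  obtain ⟨lρ, eρ⟩ := emh_growth_memLp hXL hXm0 hρ hρK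
  have hκ0 := H.κ0 s t h0 h1 h2
  have hκL := H.κL s t h0 h1 h2
  rw [← hh] at hκL
  set k := κ s t with hk
  set A : Ω → ℝ := fun ω => μ (X ω) * h + ρ (X ω) * k with hA
  set B1 : Ω → ℝ := fun ω => σ (X ω) * (W t ω - W s ω) with hB1
  set B2 : Ω → ℝ := fun ω => ρ (X ω) * (N t ω - N s ω - k) with hB2
  have hY : ∀ ω, emhIncr μ σ ρ W N s t X ω = A ω + (B1 ω + B2 ω) := by
    intro ω; simp only [emhIncr, hA, hB1, hB2]; ring
  have hYf : emhIncr μ σ ρ W N s t X = fun ω => A ω + (B1 ω + B2 ω) := funext hY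
  have hσX : Measurable[F s] (fun ω => σ (X ω)) := hσ.comp hXm
  have hρX : Measurable[F s] (fun ω => ρ (X ω)) := hρ.comp hXm
  have hμX : Measurable[F s] (fun ω => μ (X ω)) := hμ.comp hXm
  have hAm : Measurable[F s] A := (hμX.mul_const _).add (hρX.mul_const _)
  have hAL : MemLp A 2 P := (lμ.mul_const h).add (lρ.mul_const k)
  obtain ⟨lB1, eB1⟩ := emh_mul (F.le s) hσX lσ (H.lW s t h0 h1 h2) (H.iW s t h0 h1 h2)
  obtain ⟨lB2, eB2⟩ := emh_mul (F.le s) hρX lρ (H.lN s t h0 h1 h2) (H.iN s t h0 h1 h2)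
  rw [H.vW s t h0 h1 h2] at eB1
  rw [H.vN s t h0 h1 h2] at eB2
  set m2 := ∫ ω, X ω ^ 2 ∂P with hm2
  have hm20 : 0 ≤ m2 := integral_nonneg fun ω => sq_nonneg _
  have hBL : MemLp (fun ω => B1 ω + B2 ω) 2 P := lB1.add lB2
  have hAb : ∀ ω, |A ω| ≤ K * (1 + L) * h * (1 + |X ω|) := by
    intro ω
    have e1 : |A ω| ≤ |μ (X ω)| * h + |ρ (X ω)| * k := by
      refine (abs_add_le _ _).trans ?_
      rw [abs_mul, abs_mul, abs_of_nonneg hh0, abs_of_nonneg hκ0]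
    have e2 := mul_le_mul_of_nonneg_right (hμK (X ω)) hh0
    have e3 : |ρ (X ω)| * k ≤ K * (1 + |X ω|) * (L * h) :=
      mul_le_mul (hρK (X ω)) hκL hκ0 (by positivity)
    nlinarith
  have hA2 : ∀ ω, A ω ^ 2 ≤ a * h * (1 + X ω ^ 2) := by
    intro ω
    have e1 : A ω ^ 2 ≤ (K * (1 + L) * h * (1 + |X ω|)) ^ 2 := by
      rw [← sq_abs (A _)]; exact pow_le_pow_left₀ (abs_nonneg _) (hAb ω) 2
    have e2 : (1 + |X ω|) ^ 2 ≤ 2 * (1 + X ω ^ 2) := by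
      nlinarith [sq_nonneg (1 - |X ω|), sq_abs (X ω)]
    have e3 : h ^ 2 ≤ h := by nlinarith
    calc A ω ^ 2 ≤ (K * (1 + L) * h * (1 + |X ω|)) ^ 2 := e1
      _ = (K * (1 + L)) ^ 2 * h ^ 2 * (1 + |X ω|) ^ 2 := by ring
      _ ≤ (K * (1 + L)) ^ 2 * h * (2 * (1 + X ω ^ 2)) := by gcongr
      _ = a * h * (1 + X ω ^ 2) := by rw [ha]; ring
  have hXA : ∀ ω, 2 * (X ω * A ω) ≤ 3 * (K * (1 + L)) * h * (1 + X ω ^ 2) := by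
    intro ω
    have e1 : X ω * A ω ≤ |X ω| * (K * (1 + L) * h * (1 + |X ω|)) := by
      refine (le_abs_self _).trans ?_
      rw [abs_mul]
      exact mul_le_mul_of_nonneg_left (hAb ω) (abs_nonneg _)
    have e2 : 2 * (|X ω| * (1 + |X ω|)) ≤ 3 * (1 + X ω ^ 2) := by
      nlinarith [sq_nonneg (1 - |X ω|), sq_abs (X ω)]
    have e3 : 0 ≤ K * (1 + L) * h := by positivity
    nlinarith [mul_le_mul_of_nonneg_left e2 e3]
  have i1X : Integrable (fun ω => 1 + X ω ^ 2) P := (integrable_const _).add hXL.integrable_sq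
  have e1X : ∫ ω, (1 + X ω ^ 2) ∂P = 1 + m2 := by
    rw [integral_add (integrable_const _) hXL.integrable_sq]; simp [hm2]
  have EA : ∫ ω, A ω ^ 2 ∂P ≤ a * h * (1 + m2) := by
    rw [← e1X, ← integral_const_mul]
    exact integral_mono hAL.integrable_sq (i1X.const_mul _) hA2
  have EXA : ∫ ω, 2 * (X ω * A ω) ∂P ≤ 3 * (K * (1 + L)) * h * (1 + m2) := by
    rw [← e1X, ← integral_const_mul]
    exact integral_mono ((hXL.integrable_mul hAL).const_mul 2) (i1X.const_mul _) hXA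
  have EB : ∫ ω, (B1 ω + B2 ω) ^ 2 ∂P ≤ b * h * (1 + m2) := by
    have e1 : ∫ ω, (B1 ω + B2 ω) ^ 2 ∂P ≤ ∫ ω, (2 * B1 ω ^ 2 + 2 * B2 ω ^ 2) ∂P := by
      refine integral_mono hBL.integrable_sq
        ((lB1.integrable_sq.const_mul 2).add (lB2.integrable_sq.const_mul 2)) fun ω => ?_
      show (B1 ω + B2 ω) ^ 2 ≤ 2 * B1 ω ^ 2 + 2 * B2 ω ^ 2
      nlinarith [sq_nonneg (B1 ω - B2 ω)]
    rw [integral_add (lB1.integrable_sq.const_mul 2) (lB2.integrable_sq.const_mul 2),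
      integral_const_mul, integral_const_mul, eB1, eB2] at e1
    have e2 := mul_le_mul_of_nonneg_right eσ hh0
    have e3 : (∫ ω, ρ (X ω) ^ 2 ∂P) * k ≤ (2 * K ^ 2 * (1 + m2)) * (L * h) :=
      mul_le_mul eρ hκL hκ0 (by positivity)
    rw [hb]
    nlinarith
  have mB : Measurable[F t] (emhIncr μ σ ρ W N s t X) := by
    have hle := F.mono h1
    have q1 := H.mW t h4 h2
    have q2 := (H.mW s h0 h5).mono hle le_rfl
    have q3 := H.mN t h4 h2
    have q4 := (H.mN s h0 h5).mono hle le_rfl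
    have p1 := hμX.mono hle le_rfl
    have p2 := hσX.mono hle le_rfl
    have p3 := hρX.mono hle le_rfl
    exact ((p1.mul_const _).add (p2.mul (q1.sub q2))).add (p3.mul (q3.sub q4))
  have c1 : ∫ ω, (X ω + A ω) * B1 ω ∂P = 0 := by
    have := emh_mul_zero (F.le s) ((hXm.add hAm).mul hσX) ((hXL.add hAL).integrable_mul lσ)
      (H.lW s t h0 h1 h2) (H.iW s t h0 h1 h2) (H.eW s t h0 h1 h2)
    rw [← this]; congr 1; ext ω; simp [hB1, mul_assoc]
  have c2 : ∫ ω, (X ω + A ω) * B2 ω ∂P = 0 := by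
    have := emh_mul_zero (F.le s) ((hXm.add hAm).mul hρX) ((hXL.add hAL).integrable_mul lρ)
      (H.lN s t h0 h1 h2) (H.iN s t h0 h1 h2) (H.eN s t h0 h1 h2)
    rw [← this]; congr 1; ext ω; simp [hB2, hk, mul_assoc]
  have nn : 0 ≤ h * (1 + m2) := by positivity
  refine ⟨mB, by rw [hYf]; exact hAL.add hBL, ?_, ?_⟩
  · have e1 : ∫ ω, (emhIncr μ σ ρ W N s t X ω) ^ 2 ∂P
        ≤ ∫ ω, (2 * A ω ^ 2 + 2 * (B1 ω + B2 ω) ^ 2) ∂P := by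
      rw [hYf]
      refine integral_mono (hAL.add hBL).integrable_sq
        ((hAL.integrable_sq.const_mul 2).add (hBL.integrable_sq.const_mul 2)) fun ω => ?_
      show (A ω + (B1 ω + B2 ω)) ^ 2 ≤ 2 * A ω ^ 2 + 2 * (B1 ω + B2 ω) ^ 2
      nlinarith [sq_nonneg (A ω - (B1 ω + B2 ω))]
    rw [integral_add (hAL.integrable_sq.const_mul 2) (hBL.integrable_sq.const_mul 2),
      integral_const_mul, integral_const_mul] at e1
    have : 0 ≤ 3 * (K * (1 + L)) * h * (1 + m2) := by positivity
    nlinarith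
  · have e1 : ∫ ω, (X ω + emhIncr μ σ ρ W N s t X ω) ^ 2 ∂P
        = ∫ ω, (((X ω ^ 2 + 2 * (X ω * A ω)) + A ω ^ 2)
            + (2 * ((X ω + A ω) * B1 ω) + 2 * ((X ω + A ω) * B2 ω))
            + (B1 ω + B2 ω) ^ 2) ∂P := by
      congr 1; ext ω; rw [hY]; ring
    have j1 := hXL.integrable_sq
    have j2 := (hXL.integrable_mul hAL).const_mul 2
    have j3 := hAL.integrable_sq
    have j4 := ((hXL.add hAL).integrable_mul lB1).const_mul 2
    have j5 := ((hXL.add hAL).integrable_mul lB2).const_mul 2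
    have j6 := hBL.integrable_sq
    have e2 : ∫ ω, (((X ω ^ 2 + 2 * (X ω * A ω)) + A ω ^ 2)
            + (2 * ((X ω + A ω) * B1 ω) + 2 * ((X ω + A ω) * B2 ω))
            + (B1 ω + B2 ω) ^ 2) ∂P
        = ((m2 + ∫ ω, 2 * (X ω * A ω) ∂P) + ∫ ω, A ω ^ 2 ∂P)
          + (2 * ∫ ω, (X ω + A ω) * B1 ω ∂P + 2 * ∫ ω, (X ω + A ω) * B2 ω ∂P)
          + ∫ ω, (B1 ω + B2 ω) ^ 2 ∂P := by
      rw [← integral_const_mul 2 (fun ω => (X ω + A ω) * B1 ω),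
        ← integral_const_mul 2 (fun ω => (X ω + A ω) * B2 ω)]
      have z1 := integral_add ((j1.add j2).add j3 |>.add (j4.add j5)) j6
      have z2 := integral_add ((j1.add j2).add j3) (j4.add j5)
      have z3 := integral_add (j1.add j2) j3
      have z4 := integral_add j1 j2
      have z5 := integral_add j4 j5
      simp only [Pi.add_apply, Pi.mul_apply] at z1 z2 z3 z4 z5
      rw [z1, z2, z3, z4, z5]
    rw [e1, e2, c1, c2]
    have : 0 ≤ a * (h * (1 + m2)) := by positivity
    have : 0 ≤ b * (h * (1 + m2)) := by positivity
    nlinarith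

lemma emh_grid {Ω : Type*} {m0 : MeasurableSpace Ω} {F : Filtration ℝ m0} {P : Measure Ω}
    [IsProbabilityMeasure P] {T L : ℝ} {W N : ℝ → Ω → ℝ} {κ : ℝ → ℝ → ℝ}
    (H : EMNoise F P T L W N κ) {μ σ ρ : ℝ → ℝ} (hμ : Measurable μ) (hσ : Measurable σ)
    (hρ : Measurable ρ) {K : ℝ} (hμK : ∀ x, |μ x| ≤ K * (1 + |x|))
    (hσK : ∀ x, |σ x| ≤ K * (1 + |x|)) (hρK : ∀ x, |ρ x| ≤ K * (1 + |x|)) (ξ : ℝ) :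
    ∃ C : ℝ, 0 < C ∧ ∀ δ, 0 < δ → δ < 1 →
      (∀ k : ℕ, (k:ℝ) * δ ≤ T → ∀ t, (k:ℝ) * δ ≤ t → t ≤ T → t - (k:ℝ) * δ ≤ δ →
        Measurable[F t] (emhIncr μ σ ρ W N ((k:ℝ) * δ) t (emGrid μ σ ρ W N δ ξ k)) ∧
        MemLp (emhIncr μ σ ρ W N ((k:ℝ) * δ) t (emGrid μ σ ρ W N δ ξ k)) 2 P ∧
        ∫ ω, (emhIncr μ σ ρ W N ((k:ℝ) * δ) t (emGrid μ σ ρ W N δ ξ k) ω) ^ 2 ∂P ≤ C * δ) := by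
  obtain ⟨C, hC0, hC⟩ := emh_step H hμ hσ hρ hμK hσK hρK
  refine ⟨C * (Real.exp (C * T) * (1 + ξ ^ 2)) + 1, by positivity, ?_⟩
  intro δ hδ0 hδ1
  have key : ∀ k : ℕ, (k:ℝ) * δ ≤ T →
      Measurable[F ((k:ℝ) * δ)] (emGrid μ σ ρ W N δ ξ k) ∧
      MemLp (emGrid μ σ ρ W N δ ξ k) 2 P ∧
      1 + ∫ ω, (emGrid μ σ ρ W N δ ξ k ω) ^ 2 ∂P ≤ (1 + C * δ) ^ k * (1 + ξ ^ 2) := by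
    intro k
    induction k with
    | zero =>
      intro _
      have : emGrid μ σ ρ W N δ ξ 0 = fun _ => ξ := by ext ω; simp [emGrid]
      rw [this]
      exact ⟨measurable_const, memLp_const _, by simp⟩
    | succ k ih =>
      intro hk
      push_cast at hk
      obtain ⟨i1, i2, i3⟩ := ih (by nlinarith)
      obtain ⟨s1, s2, s3, s4⟩ := hC ((k:ℝ) * δ) (((k:ℝ) + 1) * δ) (by positivity) (by nlinarith)
        hk (by nlinarith) _ i1 i2
      have he : emGrid μ σ ρ W N δ ξ (k+1) = fun ω => emGrid μ σ ρ W N δ ξ k ω +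
          emhIncr μ σ ρ W N ((k:ℝ) * δ) (((k:ℝ) + 1) * δ) (emGrid μ σ ρ W N δ ξ k) ω := by
        ext ω; simp only [emGrid, emhIncr]; ring
      rw [he]
      have ek : ((k + 1 : ℕ) : ℝ) = (k:ℝ) + 1 := by push_cast; ring
      rw [ek]
      refine ⟨(i1.mono (F.mono (by nlinarith)) le_rfl).add s1, i2.add s2, ?_⟩
      have e : ((k:ℝ) + 1) * δ - k * δ = δ := by ring
      rw [e] at s4
      calc _ ≤ (1 + C * δ) * (1 + ∫ ω, (emGrid μ σ ρ W N δ ξ k ω) ^ 2 ∂P) := by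
            nlinarith
        _ ≤ (1 + C * δ) * ((1 + C * δ) ^ k * (1 + ξ ^ 2)) := by gcongr
        _ = _ := by ring
  intro k hk t ht1 ht2 ht3
  obtain ⟨i1, i2, i3⟩ := key k hk
  obtain ⟨s1, s2, s3, -⟩ := hC ((k:ℝ) * δ) t (by positivity) ht1 ht2 (by linarith) _ i1 i2
  refine ⟨s1, s2, s3.trans ?_⟩
  have e1 : (1 + C * δ) ^ k ≤ Real.exp (C * T) := by
    have : 1 + C * δ ≤ Real.exp (C * δ) := by linarith [Real.add_one_le_exp (C * δ)]
    calc (1 + C * δ) ^ k ≤ (Real.exp (C * δ)) ^ k := by gcongr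
      _ = Real.exp (k * (C * δ)) := by rw [← Real.exp_nat_mul]
      _ ≤ Real.exp (C * T) := by
        apply Real.exp_le_exp.mpr
        nlinarith
  have e2 : 1 + ∫ ω, (emGrid μ σ ρ W N δ ξ k ω) ^ 2 ∂P ≤ Real.exp (C * T) * (1 + ξ ^ 2) :=
    i3.trans (by gcongr)
  have e3 : 0 ≤ 1 + ∫ ω, (emGrid μ σ ρ W N δ ξ k ω) ^ 2 ∂P := by
    have : 0 ≤ ∫ ω, (emGrid μ σ ρ W N δ ξ k ω) ^ 2 ∂P := integral_nonneg fun ω => sq_nonneg _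
    linarith
  calc _ ≤ C * δ * (Real.exp (C * T) * (1 + ξ ^ 2)) := by gcongr
    _ ≤ _ := by nlinarith

set_option maxHeartbeats 1000000 in
/-- Discrete isometry for Riemann sums against the counting process. -/
lemma emh_isometry {Ω : Type*} {m0 : MeasurableSpace Ω} {F : Filtration ℝ m0} {P : Measure Ω}
    [IsProbabilityMeasure P] {T L : ℝ} {W N : ℝ → Ω → ℝ} {κ : ℝ → ℝ → ℝ}
    (H : EMNoise F P T L W N κ) (M : ℕ) (u : ℕ → ℝ) (hu0 : u 0 = 0) (hu : Monotone u)
    (huT : ∀ i ≤ M, u i ≤ T) (Z : ℕ → Ω → ℝ) (hZ : ∀ i < M, Measurable[F (u i)] (Z i))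
    (hZL : ∀ i < M, MemLp (Z i) 2 P) {B : ℝ} (hB0 : 0 ≤ B)
    (hB : ∀ i < M, ∫ ω, Z i ω ^ 2 ∂P ≤ B) :
    MemLp (fun ω => ∑ i ∈ Finset.range M, Z i ω * (N (u (i+1)) ω - N (u i) ω)) 2 P ∧
    ∫ ω, (∑ i ∈ Finset.range M, Z i ω * (N (u (i+1)) ω - N (u i) ω)) ^ 2 ∂P
      ≤ (2 * (L * T) + 2 * (L * T) ^ 2) * B := by
  have hun : ∀ i, 0 ≤ u i := fun i => hu0 ▸ hu (Nat.zero_le i)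
  have hL := H.L0
  set D : ℕ → Ω → ℝ := fun i ω => N (u (i+1)) ω - N (u i) ω - κ (u i) (u (i+1)) with hD
  set k : ℕ → ℝ := fun i => κ (u i) (u (i+1)) with hk
  have hk0 : ∀ i < M, 0 ≤ k i := fun i hi => H.κ0 _ _ (hun i) (hu (Nat.le_succ i)) (huT _ hi)
  have mart : ∀ j ≤ M, Measurable[F (u j)] (fun ω => ∑ i ∈ Finset.range j, Z i ω * D i ω) ∧
      MemLp (fun ω => ∑ i ∈ Finset.range j, Z i ω * D i ω) 2 P ∧
      ∫ ω, (∑ i ∈ Finset.range j, Z i ω * D i ω) ^ 2 ∂P ≤ L * u j * B := by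
    intro j
    induction j with
    | zero =>
      intro _
      simp [hu0]
    | succ j ih =>
      intro hj
      have hj' : j < M := hj
      obtain ⟨i1, i2, i3⟩ := ih (by omega)
      have b1 := hun j
      have b2 : u j ≤ u (j+1) := hu (Nat.le_succ j)
      have b3 := huT _ hj
      obtain ⟨l, e⟩ := emh_mul (F.le (u j)) (hZ j hj') (hZL j hj') (H.lN _ _ b1 b2 b3)
        (H.iN _ _ b1 b2 b3)
      rw [H.vN _ _ b1 b2 b3] at e
      have hDm : Measurable[F (u (j+1))] (D j) :=
        ((H.mN _ (hun _) b3).sub ((H.mN _ b1 (b2.trans b3)).mono (F.mono b2) le_rfl)).sub_const _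
      simp only [Finset.sum_range_succ]
      refine ⟨(i1.mono (F.mono b2) le_rfl).add (((hZ j hj').mono (F.mono b2) le_rfl).mul hDm),
        i2.add l, ?_⟩
      set S : Ω → ℝ := fun ω => ∑ i ∈ Finset.range j, Z i ω * D i ω with hS
      have c : ∫ ω, S ω * (Z j ω * D j ω) ∂P = 0 := by
        have := emh_mul_zero (F.le (u j)) (i1.mul (hZ j hj')) (i2.integrable_mul (hZL j hj'))
          (H.lN _ _ b1 b2 b3) (H.iN _ _ b1 b2 b3) (H.eN _ _ b1 b2 b3)
        rw [← this]; congr 1; ext ω; simp [hS, hD, mul_assoc]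
      have e1 : ∫ ω, (S ω + Z j ω * D j ω) ^ 2 ∂P = ∫ ω, S ω ^ 2 ∂P
          + 2 * ∫ ω, S ω * (Z j ω * D j ω) ∂P + ∫ ω, (Z j ω * D j ω) ^ 2 ∂P := by
        have j1 := i2.integrable_sq
        have j2 := (i2.integrable_mul l).const_mul 2
        have j3 := l.integrable_sq
        rw [← integral_const_mul]
        have z1 := integral_add (j1.add j2) j3
        have z2 := integral_add j1 j2
        simp only [Pi.add_apply, Pi.mul_apply] at z1 z2
        rw [← z2, ← z1]
        congr 1; ext ω; ring
      have e2 : ∫ ω, (Z j ω * D j ω) ^ 2 ∂P ≤ B * (L * (u (j+1) - u j)) := by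
        refine e.le.trans ?_
        exact mul_le_mul (hB j hj') (H.κL _ _ b1 b2 b3) (H.κ0 _ _ b1 b2 b3) hB0
      show ∫ ω, (S ω + Z j ω * D j ω) ^ 2 ∂P ≤ _
      rw [e1, c]
      nlinarith
  obtain ⟨-, m2, m3⟩ := mart M le_rfl
  set S : Ω → ℝ := fun ω => ∑ i ∈ Finset.range M, Z i ω * D i ω with hS
  set R : Ω → ℝ := fun ω => ∑ i ∈ Finset.range M, Z i ω * k i with hR
  have hsum : ∀ ω, ∑ i ∈ Finset.range M, Z i ω * (N (u (i+1)) ω - N (u i) ω) = S ω + R ω := by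
    intro ω
    rw [hS, hR, ← Finset.sum_add_distrib]
    refine Finset.sum_congr rfl fun i _ => ?_
    simp only [hD, hk]; ring
  have hRL : MemLp R 2 P := memLp_finsetSum _ fun i hi =>
    (hZL i (Finset.mem_range.mp hi)).mul_const (k i)
  have hksum : ∑ i ∈ Finset.range M, k i ≤ L * T := by
    have : ∑ i ∈ Finset.range M, k i ≤ ∑ i ∈ Finset.range M, L * (u (i+1) - u i) :=
      Finset.sum_le_sum fun i hi => H.κL _ _ (hun i) (hu (Nat.le_succ i))
        (huT _ (Finset.mem_range.mp hi))
    rw [← Finset.mul_sum, Finset.sum_range_sub, hu0, sub_zero] at this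
    exact this.trans (mul_le_mul_of_nonneg_left (huT M le_rfl) hL)
  have hks0 : 0 ≤ ∑ i ∈ Finset.range M, k i :=
    Finset.sum_nonneg fun i hi => hk0 i (Finset.mem_range.mp hi)
  have hLT : 0 ≤ L * T := hks0.trans hksum
  have hR2 : ∫ ω, R ω ^ 2 ∂P ≤ (L * T) ^ 2 * B := by
    have e1 : ∫ ω, R ω ^ 2 ∂P
        ≤ ∫ ω, (∑ i ∈ Finset.range M, k i) * ∑ i ∈ Finset.range M, k i * Z i ω ^ 2 ∂P := by
      refine integral_mono hRL.integrable_sq ((integrable_finsetSum _ fun i hi =>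
        ((hZL i (Finset.mem_range.mp hi)).integrable_sq.const_mul (k i))).const_mul _) fun ω => ?_
      refine Finset.sum_sq_le_sum_mul_sum_of_sq_le_mul _ (fun i hi => hk0 i (Finset.mem_range.mp hi))
        (fun i hi => mul_nonneg (hk0 i (Finset.mem_range.mp hi)) (sq_nonneg _)) fun i hi => ?_
      exact le_of_eq (by ring)
    rw [integral_const_mul, integral_finsetSum _ fun i hi =>
        ((hZL i (Finset.mem_range.mp hi)).integrable_sq.const_mul (k i))] at e1
    have e2 : ∑ i ∈ Finset.range M, ∫ ω, k i * Z i ω ^ 2 ∂P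
        ≤ (∑ i ∈ Finset.range M, k i) * B := by
      rw [Finset.sum_mul]
      refine Finset.sum_le_sum fun i hi => ?_
      rw [integral_const_mul]
      exact mul_le_mul_of_nonneg_left (hB i (Finset.mem_range.mp hi))
        (hk0 i (Finset.mem_range.mp hi))
    calc _ ≤ _ := e1
      _ ≤ (∑ i ∈ Finset.range M, k i) * ((∑ i ∈ Finset.range M, k i) * B) := by gcongr
      _ ≤ (L * T) * ((L * T) * B) := by gcongr
      _ = _ := by ring
  simp only [hsum]
  refine ⟨m2.add hRL, ?_⟩
  have e1 : ∫ ω, (S ω + R ω) ^ 2 ∂P ≤ ∫ ω, (2 * S ω ^ 2 + 2 * R ω ^ 2) ∂P := by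
    refine integral_mono (m2.add hRL).integrable_sq
      ((m2.integrable_sq.const_mul 2).add (hRL.integrable_sq.const_mul 2)) fun ω => ?_
    show (S ω + R ω) ^ 2 ≤ 2 * S ω ^ 2 + 2 * R ω ^ 2
    nlinarith [sq_nonneg (S ω - R ω)]
  rw [integral_add (m2.integrable_sq.const_mul 2) (hRL.integrable_sq.const_mul 2),
    integral_const_mul, integral_const_mul] at e1
  have e3 : L * u M * B ≤ L * T * B := by
    have := huT M le_rfl
    gcongr
  have e4 : ∫ ω, S ω ^ 2 ∂P ≤ L * T * B := m3.trans e3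
  linarith

lemma emh_h_lip (v w : ℝ) (hv : |v| ≤ 1) (hw : |w| ≤ 1) :
    |(1 - v ^ 2) ^ 3 * (v * |v|) - (1 - w ^ 2) ^ 3 * (w * |w|)| ≤ 8 * |v - w| := by
  have hp : abs (v * |v| - w * |w|) ≤ 2 * |v - w| := by
    have e : v * |v| - w * |w| = v * (|v| - |w|) + (v - w) * |w| := by ring
    rw [e]
    refine (abs_add_le _ _).trans ?_
    rw [abs_mul, abs_mul, abs_abs]
    have h1 := abs_abs_sub_abs_le v w
    have h2 : |v| * abs (|v| - |w|) ≤ 1 * |v - w| :=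
      mul_le_mul hv h1 (abs_nonneg _) zero_le_one
    have h3 : |v - w| * |w| ≤ |v - w| * 1 := mul_le_mul_of_nonneg_left hw (abs_nonneg _)
    linarith
  have hv2 : v ^ 2 ≤ 1 := by rw [← sq_abs]; nlinarith [abs_nonneg v]
  have hw2 : w ^ 2 ≤ 1 := by rw [← sq_abs]; nlinarith [abs_nonneg w]
  set q := 1 - v ^ 2 with hq
  set r := 1 - w ^ 2 with hr
  have q0 : 0 ≤ q := by linarith
  have q1 : q ≤ 1 := by nlinarith [sq_nonneg v]
  have r0 : 0 ≤ r := by linarith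
  have r1 : r ≤ 1 := by nlinarith [sq_nonneg w]
  have hqr : |q - r| ≤ 2 * |v - w| := by
    have e : q - r = (v - w) * (-(v + w)) := by rw [hq, hr]; ring
    rw [e, abs_mul, abs_neg, mul_comm]
    refine mul_le_mul_of_nonneg_right ?_ (abs_nonneg _)
    exact (abs_add_le _ _).trans (by linarith)
  have hqr3 : |q ^ 3 - r ^ 3| ≤ 6 * |v - w| := by
    have e : q ^ 3 - r ^ 3 = (q - r) * (q ^ 2 + q * r + r ^ 2) := by ring
    have h0 : 0 ≤ q ^ 2 + q * r + r ^ 2 := by positivity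
    have h3 : q ^ 2 + q * r + r ^ 2 ≤ 3 := by nlinarith
    rw [e, abs_mul, abs_of_nonneg h0]
    nlinarith [abs_nonneg (q - r), mul_le_mul_of_nonneg_left h3 (abs_nonneg (q - r))]
  have e : q ^ 3 * (v * |v|) - r ^ 3 * (w * |w|)
      = (q ^ 3 - r ^ 3) * (v * |v|) + r ^ 3 * (v * |v| - w * |w|) := by ring
  rw [e]
  refine (abs_add_le _ _).trans ?_
  rw [abs_mul (q ^ 3 - r ^ 3), abs_mul (r ^ 3), abs_of_nonneg (by positivity : 0 ≤ r ^ 3)]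
  have f1 : abs (v * |v|) ≤ 1 := by
    rw [abs_mul, abs_abs]; nlinarith [abs_nonneg v]
  have f2 : r ^ 3 ≤ 1 := pow_le_one₀ r0 r1
  have g1 : |q ^ 3 - r ^ 3| * abs (v * |v|) ≤ (6 * |v - w|) * 1 :=
    mul_le_mul hqr3 f1 (abs_nonneg _) (by positivity)
  have g2 : r ^ 3 * abs (v * |v| - w * |w|) ≤ 1 * (2 * |v - w|) :=
    mul_le_mul f2 hp (abs_nonneg _) zero_le_one
  linarith

lemma emh_phi_lip (u u' : ℝ) :
    |bumpPhi u * (u * |u|) - bumpPhi u' * (u' * |u'|)| ≤ 8 * |u - u'| := by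
  have key : ∀ u, bumpPhi u * (u * |u|) = (1 - (max (-1) (min 1 u)) ^ 2) ^ 3
      * ((max (-1) (min 1 u)) * |max (-1) (min 1 u)|) := by
    intro u
    unfold bumpPhi
    split_ifs with h
    · rw [abs_le] at h
      rw [min_eq_right h.2, max_eq_right h.1]; ring
    · rw [abs_le, not_and_or, not_le, not_le] at h
      rcases h with h | h
      · rw [min_eq_right (by linarith), max_eq_left h.le]; norm_num
      · rw [min_eq_left h.le, max_eq_right (by norm_num)]; norm_num
  have hb : ∀ u : ℝ, |max (-1) (min 1 u)| ≤ 1 := by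
    intro u
    rw [abs_le]
    exact ⟨le_max_left _ _, max_le (by norm_num) (min_le_left _ _)⟩
  rw [key u, key u']
  refine (emh_h_lip _ _ (hb u) (hb u')).trans ?_
  have h1 : |max (-1) (min 1 u) - max (-1) (min 1 u')| ≤ |u - u'| := by
    refine (abs_max_sub_max_le_max _ _ _ _).trans (max_le (by simp) ?_)
    exact (abs_min_sub_min_le_max _ _ _ _).trans (max_le (by simp) le_rfl)
  linarith

lemma emh_G_lip (m : ℕ) (ζ α : Fin m → ℝ) (c : ℝ) (hc : 0 < c) :
    ∃ K : ℝ, 0 ≤ K ∧ ∀ x y, |Gtransform m ζ α c x - Gtransform m ζ α c y| ≤ K * |x - y| := by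
  refine ⟨1 + ∑ k : Fin m, |α k| * (8 * c), by positivity, fun x y => ?_⟩
  unfold Gtransform
  have e : (x + ∑ k : Fin m, α k * bumpPhi ((x - ζ k) / c) * ((x - ζ k) * |x - ζ k|))
      - (y + ∑ k : Fin m, α k * bumpPhi ((y - ζ k) / c) * ((y - ζ k) * |y - ζ k|))
      = (x - y) + ∑ k : Fin m, (α k * bumpPhi ((x - ζ k) / c) * ((x - ζ k) * |x - ζ k|)
        - α k * bumpPhi ((y - ζ k) / c) * ((y - ζ k) * |y - ζ k|)) := by
    rw [Finset.sum_sub_distrib]; ring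
  rw [e]
  refine (abs_add_le _ _).trans ?_
  rw [add_mul, one_mul, Finset.sum_mul]
  gcongr
  refine (Finset.abs_sum_le_sum_abs _ _).trans (Finset.sum_le_sum fun k _ => ?_)
  have sc : ∀ z, z * |z| = c ^ 2 * ((z / c) * |z / c|) := by
    intro z
    rw [abs_div, abs_of_pos hc]; field_simp
  have e2 : α k * bumpPhi ((x - ζ k) / c) * ((x - ζ k) * |x - ζ k|)
        - α k * bumpPhi ((y - ζ k) / c) * ((y - ζ k) * |y - ζ k|)
      = α k * (c ^ 2 * (bumpPhi ((x - ζ k) / c) * ((x - ζ k) / c * |(x - ζ k) / c|)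
        - bumpPhi ((y - ζ k) / c) * ((y - ζ k) / c * |(y - ζ k) / c|))) := by
    rw [sc (x - ζ k), sc (y - ζ k)]; ring
  rw [e2, abs_mul, abs_mul, abs_of_pos (by positivity : 0 < c ^ 2), mul_assoc]
  refine mul_le_mul_of_nonneg_left ?_ (abs_nonneg _)
  have h := emh_phi_lip ((x - ζ k) / c) ((y - ζ k) / c)
  have e3 : (x - ζ k) / c - (y - ζ k) / c = (x - y) / c := by ring
  rw [e3, abs_div (x - y) c, abs_of_pos hc] at h
  calc _ ≤ c ^ 2 * (8 * (|x - y| / c)) := mul_le_mul_of_nonneg_left h (by positivity)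
    _ = _ := by field_simp

lemma emh_growth_on {f : ℝ → ℝ} {S : Set ℝ} (h : ∃ K : NNReal, LipschitzOnWith K f S) :
    ∃ A : ℝ, 0 ≤ A ∧ ∀ x ∈ S, |f x| ≤ A * (1 + |x|) := by
  obtain ⟨K, hK⟩ := h
  rcases S.eq_empty_or_nonempty with rfl | ⟨x0, hx0⟩
  · exact ⟨0, le_rfl, by simp⟩
  refine ⟨|f x0| + K * (1 + |x0|), by positivity, fun x hx => ?_⟩
  have h1 := hK.dist_le_mul x hx x0 hx0
  rw [Real.dist_eq, Real.dist_eq] at h1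
  have h2 : |f x| ≤ |f x0| + |f x - f x0| := by
    have := abs_add_le (f x0) (f x - f x0)
    simpa using this
  have h3 : |x - x0| ≤ |x| + |x0| := abs_sub x x0
  have hK0 : (0:ℝ) ≤ K := K.2
  have h4 : (K:ℝ) * |x - x0| ≤ K * (|x| + |x0|) := mul_le_mul_of_nonneg_left h3 hK0
  have h5 : 0 ≤ |f x0| * |x| := by positivity
  have h6 : 0 ≤ (K:ℝ) * (1 + |x0| * |x|) := by positivity
  nlinarith

lemma emh_growth_mu (μ : ℝ → ℝ) (m : ℕ) (hm : 0 < m) (ζ : Fin m → ℝ) (hζ : StrictMono ζ)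
    (hμ_low : ∃ K : NNReal, LipschitzOnWith K μ (Set.Iio (ζ ⟨0, hm⟩)))
    (hμ_high : ∃ K : NNReal, LipschitzOnWith K μ (Set.Ioi (ζ ⟨m - 1, Nat.sub_lt hm one_pos⟩)))
    (hμ_mid : ∀ (k : Fin m) (h : (k : ℕ) + 1 < m),
      ∃ K : NNReal, LipschitzOnWith K μ (Set.Ioo (ζ k) (ζ ⟨(k : ℕ) + 1, h⟩))) :
    ∃ A : ℝ, 0 ≤ A ∧ ∀ x, |μ x| ≤ A * (1 + |x|) := by
  obtain ⟨A1, h10, h1⟩ := emh_growth_on hμ_low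
  obtain ⟨A2, h20, h2⟩ := emh_growth_on hμ_high
  have hmid : ∀ k : Fin m, ∃ A : ℝ, 0 ≤ A ∧ ∀ h : (k : ℕ) + 1 < m,
      ∀ x ∈ Set.Ioo (ζ k) (ζ ⟨(k : ℕ) + 1, h⟩), |μ x| ≤ A * (1 + |x|) := by
    intro k
    by_cases h : (k : ℕ) + 1 < m
    · obtain ⟨A, hA0, hA⟩ := emh_growth_on (hμ_mid k h)
      exact ⟨A, hA0, fun _ => hA⟩
    · exact ⟨0, le_rfl, fun h' => absurd h' h⟩
  choose A hA0 hA using hmid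
  have hs0 : 0 ≤ ∑ k, A k := Finset.sum_nonneg fun k _ => hA0 k
  have ht0 : 0 ≤ ∑ k, |μ (ζ k)| := Finset.sum_nonneg fun k _ => abs_nonneg _
  refine ⟨A1 + A2 + ∑ k, A k + ∑ k, |μ (ζ k)|, by positivity, fun x => ?_⟩
  have main : ∃ B, B ≤ A1 + A2 + ∑ k, A k + ∑ k, |μ (ζ k)| ∧ |μ x| ≤ B * (1 + |x|) := by
    by_cases hx0 : x < ζ ⟨0, hm⟩
    · exact ⟨A1, by linarith, h1 x hx0⟩
    push Not at hx0
    -- the largest index `k` with `ζ k ≤ x`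
    obtain ⟨k, hk, hkmax⟩ := (Finset.univ.filter fun k : Fin m => ζ k ≤ x).exists_max_image id
      ⟨⟨0, hm⟩, by simpa using hx0⟩
    have hk' : ζ k ≤ x := by simpa using hk
    rcases hk'.eq_or_lt with e | hlt
    · refine ⟨|μ (ζ k)|, ?_, ?_⟩
      · have := Finset.single_le_sum (f := fun k => |μ (ζ k)|) (fun i _ => abs_nonneg _)
          (Finset.mem_univ k)
        linarith
      · rw [← e]
        nlinarith [abs_nonneg (μ (ζ k)), abs_nonneg (ζ k),
          mul_nonneg (abs_nonneg (μ (ζ k))) (abs_nonneg (ζ k))]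
    · by_cases h : (k : ℕ) + 1 < m
      · refine ⟨A k, ?_, hA k h x ⟨hlt, ?_⟩⟩
        · have := Finset.single_le_sum (f := A) (fun i _ => hA0 i) (Finset.mem_univ k)
          linarith
        · by_contra hcon
          push Not at hcon
          have := hkmax ⟨(k : ℕ) + 1, h⟩ (by simpa using hcon)
          simp only [id] at this
          rw [Fin.le_def] at this
          simp at this
      · refine ⟨A2, by linarith, h2 x ?_⟩
        have e : k = ⟨m - 1, Nat.sub_lt hm one_pos⟩ := by
          ext; have := k.2; simp only; omega
        rw [← e]; exact hlt
  obtain ⟨B, hB, hx⟩ := main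
  exact hx.trans (mul_le_mul_of_nonneg_right hB (by positivity))

lemma emh_growth_lip {f : ℝ → ℝ} (h : ∃ K : NNReal, LipschitzWith K f) :
    ∃ A : ℝ, 0 ≤ A ∧ ∀ x, |f x| ≤ A * (1 + |x|) := by
  obtain ⟨K, hK⟩ := h
  obtain ⟨A, h0, h1⟩ := emh_growth_on ⟨K, hK.lipschitzOnWith (s := Set.univ)⟩
  exact ⟨A, h0, fun x => h1 x (Set.mem_univ x)⟩

lemma emh_jumpTime {Ω : Type*} {N : ℝ → Ω → ℝ} {ω : Ω} {T : ℝ} (hT : 0 < T)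
    (h0 : N 0 ω = 0) (hmono : ∀ s t : ℝ, 0 ≤ s → s ≤ t → t ≤ T → N s ω ≤ N t ω)
    (hrc : ∀ t ∈ Set.Ico (0:ℝ) T,
      Filter.Tendsto (fun u => N u ω) (nhdsWithin t (Set.Ioi t)) (nhds (N t ω)))
    (j : ℕ) (hj : 1 ≤ j) (hjT : (j:ℝ) ≤ N T ω) :
    0 < jumpTime N j ω ∧ jumpTime N j ω ≤ T ∧
      ∀ t, 0 ≤ t → t ≤ T → ((j:ℝ) ≤ N t ω ↔ jumpTime N j ω ≤ t) := by
  set S := {t : ℝ | 0 ≤ t ∧ (j : ℝ) ≤ N t ω} with hS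
  have hs : jumpTime N j ω = sInf S := rfl
  rw [hs]
  have hbdd : BddBelow S := ⟨0, fun t ht => ht.1⟩
  have hne : S.Nonempty := ⟨T, hT.le, hjT⟩
  have hs0 : 0 ≤ sInf S := le_csInf hne fun t ht => ht.1
  have hsT : sInf S ≤ T := csInf_le hbdd ⟨hT.le, hjT⟩
  have hjs : (j:ℝ) ≤ N (sInf S) ω := by
    rcases hsT.eq_or_lt with e | hlt
    · rw [e]; exact hjT
    · refine ge_of_tendsto (hrc _ ⟨hs0, hlt⟩) ?_
      filter_upwards [Ioo_mem_nhdsGT hlt] with u hu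
      obtain ⟨r, hr, hru⟩ := exists_lt_of_csInf_lt hne hu.1
      exact hr.2.trans (hmono r u hr.1 hru.le hu.2.le)
  have hpos : 0 < sInf S := by
    rcases hs0.eq_or_lt with e | hlt
    · rw [← e, h0] at hjs
      have : (1:ℝ) ≤ j := by exact_mod_cast hj
      linarith
    · exact hlt
  refine ⟨hpos, hsT, fun t ht0 htT => ⟨fun h => csInf_le hbdd ⟨ht0, h⟩, fun h => ?_⟩⟩
  exact hjs.trans (hmono _ _ hs0 h htT)

lemma emh_floor {δ s : ℝ} (hδ : 0 < δ) (hs : 0 < s) (hgrid : ∀ k : ℕ, s ≠ (k:ℝ) * δ) :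
    ∀ᶠ u in nhdsWithin s (Set.Iio s), ⌊u / δ⌋ = ⌊s / δ⌋ := by
  have hlt : (⌊s / δ⌋ : ℝ) * δ < s := by
    have h1 : (⌊s / δ⌋ : ℝ) ≤ s / δ := Int.floor_le _
    rw [le_div_iff₀ hδ] at h1
    refine lt_of_le_of_ne h1 fun e => ?_
    have hnn : 0 ≤ ⌊s / δ⌋ := Int.floor_nonneg.mpr (by positivity)
    obtain ⟨k, hk⟩ := Int.eq_ofNat_of_zero_le hnn
    rw [hk] at e
    exact hgrid k (by simpa using e.symm)
  filter_upwards [Ioo_mem_nhdsLT hlt] with u hu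
  rw [Int.floor_eq_iff]
  constructor
  · rw [le_div_iff₀ hδ]; exact hu.1.le
  · have h2 : s / δ < ⌊s / δ⌋ + 1 := Int.lt_floor_add_one _
    exact (div_lt_div_of_pos_right hu.2 hδ).trans h2

lemma emh_lastGrid_nonneg_le {δ t : ℝ} (hδ : 0 < δ) (ht : 0 ≤ t) :
    ((⌊t / δ⌋.toNat : ℕ) : ℝ) * δ ≤ t ∧ t - ((⌊t / δ⌋.toNat : ℕ) : ℝ) * δ ≤ δ := by
  have hnn : 0 ≤ ⌊t / δ⌋ := Int.floor_nonneg.mpr (by positivity)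
  have e : ((⌊t / δ⌋.toNat : ℕ) : ℝ) = (⌊t / δ⌋ : ℝ) := by
    have := Int.toNat_of_nonneg hnn
    exact_mod_cast congrArg (Int.cast : ℤ → ℝ) this
  rw [e]
  have h1 : (⌊t / δ⌋ : ℝ) ≤ t / δ := Int.floor_le _
  have h2 : t / δ < ⌊t / δ⌋ + 1 := Int.lt_floor_add_one _
  rw [le_div_iff₀ hδ] at h1
  rw [div_lt_iff₀ hδ] at h2
  exact ⟨h1, by linarith⟩

lemma emh_proc_lastGrid {Ω : Type*} (μ σ ρ : ℝ → ℝ) (W N : ℝ → Ω → ℝ) {δ : ℝ} (hδ : 0 < δ)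
    (x t : ℝ) (ω : Ω) :
    emProc μ σ ρ W N δ x (lastGrid δ t) ω = emGrid μ σ ρ W N δ x (⌊t / δ⌋.toNat) ω := by
  have e : ⌊lastGrid δ t / δ⌋.toNat = ⌊t / δ⌋.toNat := by
    unfold lastGrid
    rw [mul_div_cancel_right₀ _ hδ.ne', Int.floor_natCast, Int.toNat_natCast]
  have e2 : lastGrid δ (lastGrid δ t) = lastGrid δ t := by
    show ((⌊lastGrid δ t / δ⌋.toNat : ℕ) : ℝ) * δ = _
    rw [e]; rfl
  unfold emProc
  rw [e, e2]; simp

lemma emh_proc_sub {Ω : Type*} (μ σ ρ : ℝ → ℝ) (W N : ℝ → Ω → ℝ) (δ x t : ℝ) (ω : Ω) :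
    emProc μ σ ρ W N δ x t ω - emGrid μ σ ρ W N δ x (⌊t / δ⌋.toNat) ω
      = emhIncr μ σ ρ W N (((⌊t / δ⌋.toNat : ℕ) : ℝ) * δ) t
          (emGrid μ σ ρ W N δ x (⌊t / δ⌋.toNat)) ω := by
  unfold emProc emhIncr lastGrid; ring

lemma emh_leftlim {Ω : Type*} (μ σ ρ : ℝ → ℝ) {W N : ℝ → Ω → ℝ} {δ : ℝ} (hδ : 0 < δ)
    (x : ℝ) {ω : Ω} {T : ℝ}
    (hW : ContinuousOn (fun t => W t ω) (Set.Icc 0 T))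
    (hmono : ∀ s t : ℝ, 0 ≤ s → s ≤ t → t ≤ T → N s ω ≤ N t ω)
    {s : ℝ} (hs0 : 0 < s) (hsT : s ≤ T) (hgrid : ∀ k : ℕ, s ≠ (k:ℝ) * δ) :
    Tendsto (fun u => emProc μ σ ρ W N δ x u ω - emGrid μ σ ρ W N δ x (⌊u / δ⌋.toNat) ω)
      (nhdsWithin s (Set.Iio s))
      (nhds (Function.leftLim (fun u => emProc μ σ ρ W N δ x u ω) s
        - emGrid μ σ ρ W N δ x (⌊s / δ⌋.toNat) ω)) := by
  have hT : 0 ≤ T := (hs0.trans_le hsT).le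
  have hfl := emh_floor hδ hs0 hgrid
  have hWl : Tendsto (fun u => W u ω) (nhdsWithin s (Set.Iio s)) (nhds (W s ω)) := by
    have h1 := hW s ⟨hs0.le, hsT⟩
    refine h1.mono_left ?_
    rw [nhdsWithin_le_iff]
    filter_upwards [Ioo_mem_nhdsLT hs0] with u hu
    exact ⟨hu.1.le, hu.2.le.trans hsT⟩
  obtain ⟨l, hl⟩ : ∃ l, Tendsto (fun u => N u ω) (nhdsWithin s (Set.Iio s)) (nhds l) := by
    set g : ℝ → ℝ := fun u => N (Set.projIcc 0 T hT u) ω with hg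
    have hgm : Monotone g := fun a b hab =>
      hmono _ _ (Set.projIcc 0 T hT a).2.1 (Set.monotone_projIcc hT hab) (Set.projIcc 0 T hT b).2.2
    refine ⟨_, (hgm.tendsto_leftLim s).congr' ?_⟩
    filter_upwards [Ioo_mem_nhdsLT hs0] with u hu
    simp only [hg]
    rw [Set.projIcc_of_mem hT (⟨hu.1.le, hu.2.le.trans hsT⟩ : u ∈ Set.Icc 0 T)]
  set X := emGrid μ σ ρ W N δ x (⌊s / δ⌋.toNat) ω with hX
  set r : ℝ := lastGrid δ s with hr
  have hid : Tendsto (fun u : ℝ => u) (nhdsWithin s (Set.Iio s)) (nhds s) :=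
    tendsto_id.mono_left nhdsWithin_le_nhds
  have hlim : Tendsto (fun u => emProc μ σ ρ W N δ x u ω) (nhdsWithin s (Set.Iio s))
      (nhds (X + μ X * (s - r) + σ X * (W s ω - W r ω) + ρ X * (l - N r ω))) := by
    have h1 : Tendsto (fun u => X + μ X * (u - r) + σ X * (W u ω - W r ω) + ρ X * (N u ω - N r ω))
        (nhdsWithin s (Set.Iio s))
        (nhds (X + μ X * (s - r) + σ X * (W s ω - W r ω) + ρ X * (l - N r ω))) :=
      ((tendsto_const_nhds.add ((hid.sub_const r).const_mul _)).add
        ((hWl.sub_const _).const_mul _)).add ((hl.sub_const _).const_mul _)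
    refine h1.congr' ?_
    filter_upwards [hfl] with u hu
    have e : lastGrid δ u = r := by rw [hr]; unfold lastGrid; rw [hu]
    unfold emProc
    rw [hu, e]
  rw [leftLim_eq_of_tendsto hlim]
  refine (hlim.sub (tendsto_const_nhds (x := X))).congr' ?_
  filter_upwards [hfl] with u hu
  rw [hu]

lemma emh_no_jump {Ω : Type*} {m0 : MeasurableSpace Ω} {F : Filtration ℝ m0} {P : Measure Ω}
    [IsProbabilityMeasure P] {T L : ℝ} {W N : ℝ → Ω → ℝ} {κ : ℝ → ℝ → ℝ}
    (H : EMNoise F P T L W N κ) {t : ℝ} (ht0 : 0 < t) (htT : t ≤ T) :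
    ∀ᵐ ω ∂P, ∃ u, 0 ≤ u ∧ u < t ∧ N t ω - N u ω < 1 := by
  have hL := H.L0
  rw [ae_iff]
  set E := {ω | ¬ ∃ u, 0 ≤ u ∧ u < t ∧ N t ω - N u ω < 1} with hE
  have key : ∀ u, 0 ≤ u → u < t →
      P E ≤ ENNReal.ofReal (2 * (L * (t - u)) + 2 * (L * (t - u)) ^ 2) := by
    intro u hu0 hut
    have hl := H.lN u t hu0 hut.le htT
    have hκ0 := H.κ0 u t hu0 hut.le htT
    have hκL := H.κL u t hu0 hut.le htT
    have hv := H.vN u t hu0 hut.le htT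
    have hi : Integrable (fun ω => 2 * (N t ω - N u ω - κ u t) ^ 2 + 2 * κ u t ^ 2) P :=
      (hl.integrable_sq.const_mul 2).add (integrable_const _)
    have hmeas : Measurable (N t) := (H.mN t ht0.le htT).mono (F.le _) le_rfl
    have hmeas' : Measurable (N u) := (H.mN u hu0 (hut.le.trans htT)).mono (F.le _) le_rfl
    have h1 : P E ≤ P {ω | 1 ≤ ENNReal.ofReal
        (2 * (N t ω - N u ω - κ u t) ^ 2 + 2 * κ u t ^ 2)} := by
      refine measure_mono fun ω hω => ?_
      have h2 : 1 ≤ N t ω - N u ω := by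
        by_contra hcon
        exact hω ⟨u, hu0, hut, not_le.mp hcon⟩
      show 1 ≤ ENNReal.ofReal _
      rw [ENNReal.one_le_ofReal]
      nlinarith [sq_nonneg (N t ω - N u ω - 2 * κ u t)]
    have h2 := mul_meas_ge_le_lintegral (μ := P) (f := fun ω => ENNReal.ofReal
        (2 * (N t ω - N u ω - κ u t) ^ 2 + 2 * κ u t ^ 2)) (by fun_prop) 1
    rw [one_mul, ← ofReal_integral_eq_lintegral_ofReal hi
      (ae_of_all _ fun ω => by positivity),
      integral_add (hl.integrable_sq.const_mul 2) (integrable_const _), integral_const_mul, hv] at h2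
    refine (h1.trans h2).trans (ENNReal.ofReal_le_ofReal ?_)
    simp only [integral_const, probReal_univ, smul_eq_mul, one_mul]
    gcongr
  have hlim : Tendsto (fun u => ENNReal.ofReal (2 * (L * (t - u)) + 2 * (L * (t - u)) ^ 2))
      (nhdsWithin t (Set.Iio t)) (nhds 0) := by
    have hc : Continuous (fun u : ℝ =>
        ENNReal.ofReal (2 * (L * (t - u)) + 2 * (L * (t - u)) ^ 2)) :=
      ENNReal.continuous_ofReal.comp (by fun_prop)
    have := (hc.tendsto t).mono_left (nhdsWithin_le_nhds (s := Set.Iio t))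
    simpa using this
  refine le_antisymm (ge_of_tendsto hlim ?_) zero_le
  filter_upwards [Ioo_mem_nhdsLT ht0] with u hu
  exact key u hu.1.le hu.2

lemma emh_sum_blocks (ν : ℕ → ℕ) (h0 : ν 0 = 0) (M : ℕ) (hν : ∀ i < M, ν i ≤ ν (i+1))
    (z f : ℕ → ℝ)
    (hf : ∀ i < M, ∀ j, ν i < j → j ≤ ν (i+1) → f j = z i) :
    ∑ i ∈ Finset.range M, z i * ((ν (i+1) : ℝ) - ν i) = ∑ j ∈ Finset.Ioc 0 (ν M), f j := by
  induction M with
  | zero => simp [h0]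
  | succ M ih =>
    rw [Finset.sum_range_succ, ih (fun i hi => hν i (by omega)) (fun i hi => hf i (by omega)),
      ← Finset.sum_Ioc_consecutive f (Nat.zero_le (ν M)) (hν M (by omega))]
    congr 1
    rw [Finset.sum_congr rfl (g := fun _ => z M) fun j hj => by
      rw [Finset.mem_Ioc] at hj; exact hf M (by omega) j hj.1 hj.2]
    rw [Finset.sum_const, Nat.card_Ioc, nsmul_eq_mul, Nat.cast_sub (hν M (by omega))]
    ring

/-- Left endpoint of the mesh interval `(i h, (i+1) h]` containing `s`. -/
noncomputable def emhLeft (h s : ℝ) : ℝ := ((⌈s / h⌉₊ - 1 : ℕ) : ℝ) * h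

lemma emh_left_spec {h s : ℝ} (hh : 0 < h) (hs : 0 < s) :
    emhLeft h s < s ∧ s ≤ emhLeft h s + h ∧
      ∀ i : ℕ, (i:ℝ) * h < s → s ≤ ((i:ℝ) + 1) * h → emhLeft h s = (i:ℝ) * h := by
  have hpos : 0 < ⌈s / h⌉₊ := Nat.ceil_pos.mpr (by positivity)
  obtain ⟨p, hp⟩ : ∃ p, ⌈s / h⌉₊ = p + 1 := ⟨⌈s / h⌉₊ - 1, by omega⟩
  have h1 : s / h ≤ (p:ℝ) + 1 := by
    have := Nat.le_ceil (s / h); rw [hp] at this; push_cast at this; exact this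
  have h2 : (p:ℝ) < s / h := by
    have := Nat.ceil_lt_add_one (show 0 ≤ s / h by positivity)
    rw [hp] at this; push_cast at this; linarith
  have e : emhLeft h s = p * h := by unfold emhLeft; rw [hp]; simp
  rw [div_le_iff₀ hh] at h1
  rw [lt_div_iff₀ hh] at h2
  rw [e]
  refine ⟨h2, by linarith, fun i hi1 hi2 => ?_⟩
  have a1 : (p:ℝ) < (i:ℝ) + 1 := lt_of_mul_lt_mul_right (h2.trans_le hi2) hh.le
  have a2 : (i:ℝ) < (p:ℝ) + 1 := lt_of_mul_lt_mul_right (hi1.trans_le h1) hh.le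
  have a3 : p < i + 1 := by exact_mod_cast a1
  have a4 : i < p + 1 := by exact_mod_cast a2
  have : p = i := by omega
  rw [this]

lemma emh_left_tendsto {T s : ℝ} (hT : 0 < T) (hs : 0 < s) :
    Tendsto (fun M : ℕ => emhLeft (T / ((M:ℝ) + 1)) s) atTop (nhdsWithin s (Set.Iio s)) := by
  have hlim : Tendsto (fun M : ℕ => T / ((M:ℝ) + 1)) atTop (nhds 0) :=
    tendsto_const_div_atTop_nhds_zero_nat T |>.comp (tendsto_add_atTop_nat 1) |>.congr
      fun M => by simp
  have hsp : ∀ M : ℕ, 0 < T / ((M:ℝ) + 1) := fun M => by positivity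
  rw [tendsto_nhdsWithin_iff]
  refine ⟨?_, Eventually.of_forall fun M => (emh_left_spec (hsp M) hs).1⟩
  have h1 : Tendsto (fun M : ℕ => s - T / ((M:ℝ) + 1)) atTop (nhds s) := by
    simpa using hlim.const_sub s
  refine tendsto_of_tendsto_of_tendsto_of_le_of_le h1 tendsto_const_nhds (fun M => ?_) fun M => ?_
  · have := (emh_left_spec (hsp M) hs).2.1
    show s - T / ((M:ℝ) + 1) ≤ _
    linarith
  · exact (emh_left_spec (hsp M) hs).1.le

/-- Pathwise identity: Riemann sums are sums over jump times. -/
lemma emh_path_sum {Ω : Type*} {N : ℝ → Ω → ℝ} {ω : Ω} {T : ℝ} (hT : 0 < T)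
    (h0 : N 0 ω = 0) (hmono : ∀ s t : ℝ, 0 ≤ s → s ≤ t → t ≤ T → N s ω ≤ N t ω)
    (hrc : ∀ t ∈ Set.Ico (0:ℝ) T,
      Filter.Tendsto (fun u => N u ω) (nhdsWithin t (Set.Ioi t)) (nhds (N t ω)))
    (hint : ∀ t ∈ Set.Icc (0:ℝ) T, ∃ k : ℕ, N t ω = k) (z : ℝ → ℝ) (M : ℕ) :
    ∑ i ∈ Finset.range (M+1), z ((i:ℝ) * (T / ((M:ℝ) + 1))) *
        (N (((i + 1 : ℕ):ℝ) * (T / ((M:ℝ) + 1))) ω - N ((i:ℝ) * (T / ((M:ℝ) + 1))) ω)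
      = ∑ j ∈ Finset.Icc 1 (⌊N T ω⌋.toNat), z (emhLeft (T / ((M:ℝ) + 1)) (jumpTime N j ω)) := by
  set h := T / ((M:ℝ) + 1) with hh
  have hpos : 0 < h := by positivity
  have hMh : ((M:ℝ) + 1) * h = T := by rw [hh]; field_simp
  have hle : ∀ i ≤ M + 1, (i:ℝ) * h ≤ T := by
    intro i hi
    have : (i:ℝ) ≤ (M:ℝ) + 1 := by exact_mod_cast hi
    rw [← hMh]; gcongr
  have hge : ∀ i : ℕ, 0 ≤ (i:ℝ) * h := fun i => by positivity
  set ν : ℕ → ℕ := fun i => ⌊N ((i:ℝ) * h) ω⌋.toNat with hνdef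
  have hν : ∀ i ≤ M + 1, N ((i:ℝ) * h) ω = (ν i : ℝ) := by
    intro i hi
    obtain ⟨k, hk⟩ := hint _ ⟨hge i, hle i hi⟩
    simp only [hνdef, hk]; simp
  have hνm : ∀ i < M + 1, ν i ≤ ν (i+1) := by
    intro i hi
    have := hmono ((i:ℝ) * h) (((i+1:ℕ):ℝ) * h) (hge i) (by gcongr; simp) (hle _ hi)
    rw [hν i hi.le, hν (i+1) hi] at this
    exact_mod_cast this
  have hνmono : ∀ i ≤ M + 1, ν i ≤ ν (M+1) := by
    intro i hi
    have := hmono ((i:ℝ) * h) (((M+1:ℕ):ℝ) * h) (hge i) (by gcongr) (hle _ le_rfl)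
    rw [hν i hi, hν (M+1) le_rfl] at this
    exact_mod_cast this
  have hT' : ((M+1:ℕ):ℝ) * h = T := by push_cast; exact hMh
  have hνT : ν (M+1) = ⌊N T ω⌋.toNat := by simp only [hνdef, hT']
  have hNT : N T ω = (ν (M+1) : ℝ) := by rw [← hν (M+1) le_rfl, hT']
  rw [← hνT]
  have := emh_sum_blocks ν (by simp [hνdef, h0]) (M+1) hνm (fun i => z ((i:ℝ) * h))
    (fun j => z (emhLeft h (jumpTime N j ω))) (by
      intro i hi j hj1 hj2
      have hjT : (j:ℝ) ≤ N T ω := by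
        rw [hNT]; exact_mod_cast hj2.trans (hνmono _ hi)
      obtain ⟨s0, sT, siff⟩ := emh_jumpTime hT h0 hmono hrc j (by omega) hjT
      have a1 : (i:ℝ) * h < jumpTime N j ω := by
        rw [← not_le, ← siff _ (hge i) (hle i hi.le), hν i hi.le, not_le]
        exact_mod_cast hj1
      have a2 : jumpTime N j ω ≤ ((i:ℝ) + 1) * h := by
        have e : ((i:ℝ) + 1) * h = ((i+1:ℕ):ℝ) * h := by push_cast; ring
        rw [e, ← siff _ (hge _) (hle _ hi), hν _ hi]
        exact_mod_cast hj2
      show z _ = z _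
      rw [(emh_left_spec hpos s0).2.2 i a1 a2])
  have eI : Finset.Icc 1 (ν (M+1)) = Finset.Ioc 0 (ν (M+1)) := by
    ext j; simp [Nat.succ_le_iff]
  rw [eI, ← this]
  refine Finset.sum_congr rfl fun i hi => ?_
  have hi' := Finset.mem_range.mp hi
  rw [hν i hi'.le, hν (i+1) hi']

end EMHelpers

/-- Estimate of the jump part of the transformed Euler–Maruyama error:
`E[sup_{τ ∈ [0,T]} |∫_{(0,τ]} (ς(X_{s̲}, X_{s̲}) - ς(X_{s-}, X_{s̲})) dN_s|²] ≤ C δ`,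
the pathwise Lebesgue–Stieltjes integral being written as the sum of the integrand over the
jump times of `N` in `(0, τ]`. -/
theorem em_transformed_jump_estimate
    {Ω : Type*} {m0 : MeasurableSpace Ω}
    (F : Filtration ℝ m0) (P : Measure Ω) [IsProbabilityMeasure P]
    (T : ℝ) (hT : 0 < T)
    (lam : ℝ → ℝ) (hlam_meas : Measurable lam)
    (hlam_pos : ∀ t ∈ Set.Icc (0:ℝ) T, 0 < lam t)
    (lamB : ℝ) (hlamB : ∀ t ∈ Set.Icc (0:ℝ) T, lam t ≤ lamB)
    (W N : ℝ → Ω → ℝ)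
    (hW0 : ∀ ω, W 0 ω = 0) (hN0 : ∀ ω, N 0 ω = 0)
    (hW_adapted : ∀ t ∈ Set.Icc (0:ℝ) T, Measurable[F t] (W t))
    (hN_adapted : ∀ t ∈ Set.Icc (0:ℝ) T, Measurable[F t] (N t))
    (hW_cont : ∀ᵐ ω ∂P, ContinuousOn (fun t => W t ω) (Set.Icc 0 T))
    (hN_mono : ∀ᵐ ω ∂P, ∀ s t : ℝ, 0 ≤ s → s ≤ t → t ≤ T → N s ω ≤ N t ω)
    (hN_rc : ∀ᵐ ω ∂P, ∀ t ∈ Set.Ico (0:ℝ) T,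
      Filter.Tendsto (fun u => N u ω) (nhdsWithin t (Set.Ioi t)) (nhds (N t ω)))
    (hN_int : ∀ᵐ ω ∂P, ∀ t ∈ Set.Icc (0:ℝ) T, ∃ k : ℕ, N t ω = k)
    (hW_gauss : ∀ s t : ℝ, 0 ≤ s → s ≤ t → t ≤ T →
      Measure.map (fun ω => W t ω - W s ω) P = gaussianReal 0 (Real.toNNReal (t - s)))
    (hN_poisson : ∀ s t : ℝ, 0 ≤ s → s ≤ t → t ≤ T →
      Measure.map (fun ω => N t ω - N s ω) P
        = Measure.map (fun k : ℕ => (k : ℝ))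
            (poissonMeasure (Real.toNNReal (∫ u in s..t, lam u))))
    (h_indep : ∀ s t : ℝ, 0 ≤ s → s ≤ t → t ≤ T →
      Indep (MeasurableSpace.comap (fun ω => (W t ω - W s ω, N t ω - N s ω)) inferInstance)
        (F s) P)
    (hWN_indep : ∀ s t : ℝ, 0 ≤ s → s ≤ t → t ≤ T →
      IndepFun (fun ω => W t ω - W s ω) (fun ω => N t ω - N s ω) P)
    (μ σ ρ : ℝ → ℝ) (hμ_meas : Measurable μ) (hσ_meas : Measurable σ) (hρ_meas : Measurable ρ)
    (m : ℕ) (hm : 0 < m) (ζ : Fin m → ℝ) (hζ : StrictMono ζ)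
    (hμ_low : ∃ K : NNReal, LipschitzOnWith K μ (Set.Iio (ζ ⟨0, hm⟩)))
    (hμ_high : ∃ K : NNReal, LipschitzOnWith K μ (Set.Ioi (ζ ⟨m - 1, Nat.sub_lt hm one_pos⟩)))
    (hμ_mid : ∀ (k : Fin m) (h : (k : ℕ) + 1 < m),
      ∃ K : NNReal, LipschitzOnWith K μ (Set.Ioo (ζ k) (ζ ⟨(k : ℕ) + 1, h⟩)))
    (hσ_lip : ∃ K : NNReal, LipschitzWith K σ)
    (hσ_nz : ∀ k : Fin m, σ (ζ k) ≠ 0)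
    (hρ_lip : ∃ K : NNReal, LipschitzWith K ρ)
    (μm μp : Fin m → ℝ)
    (hμm : ∀ k : Fin m, Filter.Tendsto μ (nhdsWithin (ζ k) (Set.Iio (ζ k))) (nhds (μm k)))
    (hμp : ∀ k : Fin m, Filter.Tendsto μ (nhdsWithin (ζ k) (Set.Ioi (ζ k))) (nhds (μp k)))
    (α : Fin m → ℝ) (hα_def : ∀ k : Fin m, α k = (μm k - μp k) / (2 * σ (ζ k) ^ 2))
    (hα_ne : ∀ k : Fin m, α k ≠ 0)
    (c : ℝ) (hc0 : 0 < c) (hc1 : ∀ k : Fin m, c < 1 / (6 * |α k|))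
    (hc2 : ∀ (k : Fin m) (h : (k : ℕ) + 1 < m), c < (ζ ⟨(k : ℕ) + 1, h⟩ - ζ k) / 2)
    (ξ : ℝ) :
    ∃ C : ℝ, 0 < C ∧ ∀ n : ℕ, 0 < n → T / n < 1 →
      ∫⁻ ω, ⨆ τ : Set.Icc (0:ℝ) T,
          ENNReal.ofReal (|∑ j ∈ Finset.Icc 1 (⌊N (τ : ℝ) ω⌋.toNat),
              (sigmaJump (Gtransform m ζ α c) ρ
                  (emProc μ σ ρ W N (T / n) ξ (lastGrid (T / n) (jumpTime N j ω)) ω)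
                  (emProc μ σ ρ W N (T / n) ξ (lastGrid (T / n) (jumpTime N j ω)) ω)
                - sigmaJump (Gtransform m ζ α c) ρ
                    (Function.leftLim (fun u => emProc μ σ ρ W N (T / n) ξ u ω)
                      (jumpTime N j ω))
                    (emProc μ σ ρ W N (T / n) ξ (lastGrid (T / n) (jumpTime N j ω)) ω))| ^ 2) ∂P
        ≤ ENNReal.ofReal (C * (T / n)) := by
  classical
  have H := emh_noise F P T hT lam hlam_meas hlam_pos lamB hlamB W N hW_adapted hN_adapted
    hW_gauss hN_poisson h_indep
  obtain ⟨A1, hA10, hA1⟩ := emh_growth_mu μ m hm ζ hζ hμ_low hμ_high hμ_mid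
  obtain ⟨A2, hA20, hA2⟩ := emh_growth_lip hσ_lip
  obtain ⟨A3, hA30, hA3⟩ := emh_growth_lip hρ_lip
  obtain ⟨LG, hLG0, hLG⟩ := emh_G_lip m ζ α c hc0
  obtain ⟨C, hC0, hC⟩ := emh_grid H hμ_meas hσ_meas hρ_meas (K := A1 + A2 + A3)
    (fun x => (hA1 x).trans (mul_le_mul_of_nonneg_right (by linarith) (by positivity)))
    (fun x => (hA2 x).trans (mul_le_mul_of_nonneg_right (by linarith) (by positivity)))
    (fun x => (hA3 x).trans (mul_le_mul_of_nonneg_right (by linarith) (by positivity))) ξ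
  have hlB := H.L0
  set Q : ℝ := 2 * (lamB * T) + 2 * (lamB * T) ^ 2 with hQ
  have hQ0 : 0 ≤ Q := by positivity
  refine ⟨(2 * LG) ^ 2 * (Q * C) + 1, by positivity, ?_⟩
  intro n hn hn1
  have hn' : (0:ℝ) < n := by exact_mod_cast hn
  set δ : ℝ := T / n with hδdef
  have hδ : 0 < δ := by positivity
  -- the increment process
  set Z : ℝ → Ω → ℝ := fun u ω => |emProc μ σ ρ W N δ ξ u ω
    - emGrid μ σ ρ W N δ ξ (⌊u / δ⌋.toNat) ω| with hZdef
  have hZ : ∀ u, 0 ≤ u → u ≤ T → Measurable[F u] (Z u) ∧ MemLp (Z u) 2 P ∧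
      ∫ ω, Z u ω ^ 2 ∂P ≤ C * δ := by
    intro u hu0 huT
    obtain ⟨g1, g2⟩ := emh_lastGrid_nonneg_le hδ hu0
    obtain ⟨a1, a2, a3⟩ := hC δ hδ hn1 _ (g1.trans huT) u g1 huT g2
    have e : Z u = fun ω => |emhIncr μ σ ρ W N (((⌊u / δ⌋.toNat : ℕ) : ℝ) * δ) u
          (emGrid μ σ ρ W N δ ξ (⌊u / δ⌋.toNat)) ω| := by
      ext ω; simp only [hZdef]; rw [emh_proc_sub]
    rw [e]
    refine ⟨measurable_norm.comp a1, a2.abs, ?_⟩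
    simpa only [sq_abs] using a3
  set S : ℕ → Ω → ℝ := fun M ω => ∑ i ∈ Finset.range (M+1), Z ((i:ℝ) * (T / ((M:ℝ) + 1))) ω *
        (N (((i + 1 : ℕ):ℝ) * (T / ((M:ℝ) + 1))) ω - N ((i:ℝ) * (T / ((M:ℝ) + 1))) ω) with hSdef
  have hS : ∀ M, MemLp (S M) 2 P ∧ ∫ ω, S M ω ^ 2 ∂P ≤ Q * (C * δ) := by
    intro M
    have hpos : 0 < T / ((M:ℝ) + 1) := by positivity
    have hle : ∀ i ≤ M + 1, (i:ℝ) * (T / ((M:ℝ) + 1)) ≤ T := by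
      intro i hi
      have h1 : (i:ℝ) ≤ (M:ℝ) + 1 := by exact_mod_cast hi
      calc (i:ℝ) * (T / ((M:ℝ) + 1)) ≤ ((M:ℝ) + 1) * (T / ((M:ℝ) + 1)) := by gcongr
        _ = T := by field_simp
    exact emh_isometry H (M+1) (fun i => (i:ℝ) * (T / ((M:ℝ) + 1))) (by simp)
      (fun a b hab => by
        have : (a:ℝ) ≤ b := by exact_mod_cast hab
        show (a:ℝ) * _ ≤ b * _
        gcongr) hle
      (fun i => Z ((i:ℝ) * (T / ((M:ℝ) + 1))))
      (fun i hi => (hZ _ (by positivity) (hle i hi.le)).1)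
      (fun i hi => (hZ _ (by positivity) (hle i hi.le)).2.1) (by positivity)
      (fun i hi => (hZ _ (by positivity) (hle i hi.le)).2.2)
  -- no jumps at grid points
  have hnj : ∀ᵐ ω ∂P, ∀ k : ℕ, 0 < (k:ℝ) * δ → (k:ℝ) * δ ≤ T →
      ∃ u, 0 ≤ u ∧ u < (k:ℝ) * δ ∧ N ((k:ℝ) * δ) ω - N u ω < 1 := by
    rw [ae_all_iff]
    intro k
    by_cases h1 : 0 < (k:ℝ) * δ
    · by_cases h2 : (k:ℝ) * δ ≤ T
      · filter_upwards [emh_no_jump H h1 h2] with ω hω _ _ using hω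
      · exact ae_of_all _ fun ω _ h => absurd h h2
    · exact ae_of_all _ fun ω h => absurd h h1
  have hpath : ∀ᵐ ω ∂P, (⨆ τ : Set.Icc (0:ℝ) T,
          ENNReal.ofReal (|∑ j ∈ Finset.Icc 1 (⌊N (τ : ℝ) ω⌋.toNat),
              (sigmaJump (Gtransform m ζ α c) ρ
                  (emProc μ σ ρ W N δ ξ (lastGrid δ (jumpTime N j ω)) ω)
                  (emProc μ σ ρ W N δ ξ (lastGrid δ (jumpTime N j ω)) ω)
                - sigmaJump (Gtransform m ζ α c) ρ
                    (Function.leftLim (fun u => emProc μ σ ρ W N δ ξ u ω)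
                      (jumpTime N j ω))
                    (emProc μ σ ρ W N δ ξ (lastGrid δ (jumpTime N j ω)) ω))| ^ 2))
      ≤ Filter.liminf (fun M => ENNReal.ofReal ((2 * LG * S M ω) ^ 2)) Filter.atTop := by
    filter_upwards [hW_cont, hN_mono, hN_rc, hN_int, hnj] with ω w1 w2 w3 w4 w5
    set Y : ℕ → ℝ := fun j => |Function.leftLim (fun u => emProc μ σ ρ W N δ ξ u ω)
      (jumpTime N j ω) - emGrid μ σ ρ W N δ ξ (⌊jumpTime N j ω / δ⌋.toNat) ω| with hY
    set R : ℝ := ∑ j ∈ Finset.Icc 1 (⌊N T ω⌋.toNat), Y j with hR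
    have hfl : ∀ t, 0 ≤ t → t ≤ T → ((⌊N t ω⌋.toNat : ℕ) : ℝ) = N t ω := by
      intro t h0 h1
      obtain ⟨k, hk⟩ := w4 t ⟨h0, h1⟩
      rw [hk]; simp
    have hlim : Filter.Tendsto (fun M => S M ω) Filter.atTop (nhds R) := by
      have e : ∀ M, S M ω = ∑ j ∈ Finset.Icc 1 (⌊N T ω⌋.toNat),
          Z (emhLeft (T / ((M:ℝ) + 1)) (jumpTime N j ω)) ω := fun M =>
        emh_path_sum hT (hN0 ω) w2 w3 w4 (fun u => Z u ω) M
      simp only [e]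
      refine tendsto_finsetSum _ fun j hj => ?_
      rw [Finset.mem_Icc] at hj
      have hjT : (j:ℝ) ≤ N T ω := by
        rw [← hfl T hT.le le_rfl]; exact_mod_cast hj.2
      obtain ⟨s0, sT, siff⟩ := emh_jumpTime hT (hN0 ω) w2 w3 j hj.1 hjT
      have hgrid : ∀ k : ℕ, jumpTime N j ω ≠ (k:ℝ) * δ := by
        intro k hk
        obtain ⟨u, u0, u1, u2⟩ := w5 k (hk ▸ s0) (hk ▸ sT)
        have b1 : (j:ℝ) ≤ N ((k:ℝ) * δ) ω := (siff _ (hk ▸ s0.le) (hk ▸ sT)).mpr hk.le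
        have uT : u ≤ T := u1.le.trans (hk ▸ sT)
        have b2 : N u ω < (j:ℝ) := by
          rw [← not_le, siff u u0 uT, hk, not_le]; exact u1
        rw [← hfl u u0 uT] at b2 u2
        have b3 : (⌊N u ω⌋.toNat : ℕ) + 1 ≤ j := by exact_mod_cast b2
        have b4 : ((⌊N u ω⌋.toNat : ℕ) : ℝ) + 1 ≤ j := by exact_mod_cast b3
        linarith
      have := (emh_leftlim μ σ ρ hδ ξ w1 w2 s0 sT hgrid).abs
      exact this.comp (emh_left_tendsto hT s0)
    have hlim2 : Filter.Tendsto (fun M => ENNReal.ofReal ((2 * LG * S M ω) ^ 2)) Filter.atTop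
        (nhds (ENNReal.ofReal ((2 * LG * R) ^ 2))) :=
      ENNReal.tendsto_ofReal ((hlim.const_mul (2 * LG)).pow 2)
    rw [hlim2.liminf_eq]
    refine iSup_le fun τ => ENNReal.ofReal_le_ofReal ?_
    refine pow_le_pow_left₀ (abs_nonneg _) ?_ 2
    refine (Finset.abs_sum_le_sum_abs _ _).trans ?_
    rw [hR, Finset.mul_sum]
    have hsub : Finset.Icc 1 (⌊N (τ : ℝ) ω⌋.toNat) ⊆ Finset.Icc 1 (⌊N T ω⌋.toNat) := by
      apply Finset.Icc_subset_Icc_right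
      exact Int.toNat_le_toNat (Int.floor_mono (w2 τ T τ.2.1 τ.2.2 le_rfl))
    refine (Finset.sum_le_sum fun j _ => ?_).trans
      (Finset.sum_le_sum_of_subset_of_nonneg hsub fun j _ _ => by positivity)
    rw [emh_proc_lastGrid μ σ ρ W N hδ]
    set x := emGrid μ σ ρ W N δ ξ (⌊jumpTime N j ω / δ⌋.toNat) ω with hx
    set y := Function.leftLim (fun u => emProc μ σ ρ W N δ ξ u ω) (jumpTime N j ω) with hy
    unfold sigmaJump
    have e : Gtransform m ζ α c (x + ρ x) - Gtransform m ζ α c x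
        - (Gtransform m ζ α c (y + ρ x) - Gtransform m ζ α c y)
        = (Gtransform m ζ α c (x + ρ x) - Gtransform m ζ α c (y + ρ x))
          + (Gtransform m ζ α c y - Gtransform m ζ α c x) := by ring
    rw [e]
    refine (abs_add_le _ _).trans ?_
    have f1 := hLG (x + ρ x) (y + ρ x)
    have f2 := hLG y x
    have f3 : x + ρ x - (y + ρ x) = x - y := by ring
    rw [f3, abs_sub_comm x y] at f1
    show _ ≤ 2 * LG * |y - x|
    linarith
  refine (lintegral_mono_ae hpath).trans ?_
  have hmeasN : ∀ t, 0 ≤ t → t ≤ T → Measurable (N t) := fun t h0 h1 =>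
    (hN_adapted t ⟨h0, h1⟩).mono (F.le t) le_rfl
  refine (lintegral_liminf_le' fun M => ?_).trans ?_
  · have h1 := (((hS M).1.aestronglyMeasurable.aemeasurable).const_mul (2 * LG)).pow_const 2
    exact h1.ennreal_ofReal
  · refine Filter.liminf_le_of_le (by isBoundedDefault) fun b hb => ?_
    obtain ⟨M, hM⟩ := hb.exists
    refine hM.trans ?_
    have hi : Integrable (fun ω => (2 * LG * S M ω) ^ 2) P :=
      ((hS M).1.const_mul (2 * LG)).integrable_sq
    rw [← ofReal_integral_eq_lintegral_ofReal hi (ae_of_all _ fun ω => sq_nonneg _)]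
    refine ENNReal.ofReal_le_ofReal ?_
    simp only [mul_pow _ (S M _)]
    rw [integral_const_mul]
    have := mul_le_mul_of_nonneg_left (hS M).2 (sq_nonneg (2 * LG))
    nlinarith
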